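/- arXiv:1711.02467 — 5 statements merged into one kernel-verified Lean document; each statement's English description precedes it below -/
import Mathlib

section
/- Let t > 0 with F(t) > 0 and let g : (0,∞) → ℝ be a Borel function with E[|g(τ)|] < ∞. Then ℙ-a.s., E[g(τ) | σ(ξ_t)] = (1/F(t)) ∫_{(0,t]} g(r) ℙ_τ(dr) · 1_{{ξ_t = 0}} + ∫_{(t,∞)} g(r) ϕ_{ξ^r_t}(ξ_t) ℙ_τ(dr) · 1_{{ξ_t ≠ 0}}. -/
open MeasureTheory ProbabilityTheory Real Set

open scoped NNReal ENNReal

/-- The law on `ℝ × ℝ` with first marginal governed by `ν`, whose conditional second marginal is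
`δ₀` off `S` and has Lebesgue density `k (r, ·)` for `r ∈ S`. -/
noncomputable def mixedLaw (ν : Measure ℝ) (S : Set ℝ) (k : ℝ × ℝ → ℝ≥0) : Measure (ℝ × ℝ) :=
  (ν.restrict Sᶜ).prod (Measure.dirac 0) +
    ((ν.restrict S).prod volume).withDensity fun z => (k z : ℝ≥0∞)

section MixedLaw

variable {ν : Measure ℝ} [IsProbabilityMeasure ν] {S : Set ℝ} {k : ℝ × ℝ → ℝ≥0}

lemma integrable_mixedLaw_iff (hk : Measurable k) {f : ℝ × ℝ → ℝ} (hf : Measurable f) :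
    Integrable f (mixedLaw ν S k) ↔ IntegrableOn (fun r => f (r, 0)) Sᶜ ν ∧
      Integrable (fun z => (k z : ℝ) * f z) ((ν.restrict S).prod volume) := by
  unfold mixedLaw
  rw [integrable_add_measure, Measure.prod_dirac,
    integrable_map_measure hf.aestronglyMeasurable (by fun_prop),
    integrable_withDensity_iff_integrable_smul hk]
  rfl

lemma integral_mixedLaw (hk : Measurable k) {f : ℝ × ℝ → ℝ} (hf : Measurable f)
    (hfi : Integrable f (mixedLaw ν S k)) :
    ∫ z, f z ∂(mixedLaw ν S k) = ∫ r in Sᶜ, f (r, 0) ∂ν +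
      ∫ x, ∫ r in S, (k (r, x) : ℝ) * f (r, x) ∂ν := by
  have h := (integrable_mixedLaw_iff hk hf).1 hfi
  unfold mixedLaw at hfi ⊢
  rw [integrable_add_measure] at hfi
  rw [integral_add_measure hfi.1 hfi.2, Measure.prod_dirac,
    integral_map (by fun_prop) hf.aestronglyMeasurable,
    integral_withDensity_eq_integral_smul hk]
  congr 1
  exact integral_prod_symm _ h.2

/-- Bayes' formula for `E[g(T) | Y]` when `(T, Y)` has law `mixedLaw ν S k`. -/
lemma condExp_comp_of_map_eq_mixedLaw {Ω : Type*} [MeasurableSpace Ω] {P : Measure Ω}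
    [IsProbabilityMeasure P] {T Y : Ω → ℝ} (hT : Measurable T) (hY : Measurable Y)
    (hk : Measurable k)
    (hlaw : P.map (fun ω => (T ω, Y ω)) = mixedLaw ν S k)
    {g : ℝ → ℝ} (hg : Measurable g) (hgi : Integrable (fun ω => g (T ω)) P) :
    P[(fun ω => g (T ω))|MeasurableSpace.comap Y inferInstance] =ᵐ[P]
      fun ω => if Y ω = 0 then (∫ r in Sᶜ, g r ∂ν) / ν.real Sᶜ
        else (∫ r in S, g r * k (r, Y ω) ∂ν) / ∫ r in S, (k (r, Y ω) : ℝ) ∂ν := by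
  have hTY : Measurable fun ω => (T ω, Y ω) := hT.prodMk hY
  set n : ℝ → ℝ := fun x => ∫ r in S, g r * k (r, x) ∂ν with hn
  set D : ℝ → ℝ := fun x => ∫ r in S, (k (r, x) : ℝ) ∂ν
  set a : ℝ := (∫ r in Sᶜ, g r ∂ν) / ν.real Sᶜ with ha
  have hkR : Measurable fun z => (k z : ℝ) := hk.coe_nnreal_real
  have hnm : Measurable n := by
    apply StronglyMeasurable.measurable
    apply StronglyMeasurable.integral_prod_left (f := fun r x => g r * k (r, x))
    exact ((hg.comp measurable_fst).mul hkR).stronglyMeasurable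
  have hDm : Measurable D := by
    apply StronglyMeasurable.measurable
    apply StronglyMeasurable.integral_prod_left (f := fun r x => (k (r, x) : ℝ))
    exact hkR.stronglyMeasurable
  set h : ℝ → ℝ := fun x => if x = 0 then a else n x / D x with hh
  have hhm : Measurable h :=
    Measurable.ite (measurableSet_singleton 0) measurable_const (hnm.div hDm)
  have hprob : IsProbabilityMeasure (mixedLaw ν S k) := by
    rw [← hlaw]; exact Measure.isProbabilityMeasure_map hTY.aemeasurable
  have hki : Integrable (fun z => (k z : ℝ)) ((ν.restrict S).prod volume) := by
    simpa using ((integrable_mixedLaw_iff hk measurable_const).1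
      (integrable_const (μ := mixedLaw ν S k) (1 : ℝ))).2
  have hgm : Measurable fun z : ℝ × ℝ => g z.1 := hg.comp measurable_fst
  have hgμ : Integrable (fun z : ℝ × ℝ => g z.1) (mixedLaw ν S k) := by
    rw [← hlaw, integrable_map_measure hgm.aestronglyMeasurable hTY.aemeasurable]
    exact hgi
  have hgk := (integrable_mixedLaw_iff hk hgm).1 hgμ
  have hD0 : ∀ x, 0 ≤ D x := fun x => integral_nonneg fun r => (k (r, x)).2
  have hDn : ∀ᵐ x : ℝ, D x * h x = n x := by
    filter_upwards [hki.prod_left_ae, Measure.ae_ne volume (0 : ℝ)] with x hx hx0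
    simp only [hh, if_neg hx0]
    by_cases hDx : D x = 0
    · have : (fun r => (k (r, x) : ℝ)) =ᵐ[ν.restrict S] 0 :=
        (integral_eq_zero_iff_of_nonneg (fun r => (k (r, x)).2) hx).1 hDx
      have hnx : n x = 0 := by
        apply integral_eq_zero_of_ae
        filter_upwards [this] with r hr
        simp only [Pi.zero_apply] at hr
        simp [hr]
      simp [hDx, hnx]
    · field_simp
  have hhm2 : Measurable fun z : ℝ × ℝ => h z.2 := hhm.comp measurable_snd
  have hhμ : Integrable (fun z : ℝ × ℝ => h z.2) (mixedLaw ν S k) := by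
    rw [integrable_mixedLaw_iff hk hhm2]
    refine ⟨integrable_const (h 0), ?_⟩
    have hm : Measurable fun z : ℝ × ℝ => (k z : ℝ) * h z.2 := hkR.mul hhm2
    rw [integrable_prod_iff' hm.aestronglyMeasurable]
    refine ⟨?_, ?_⟩
    · filter_upwards [hki.prod_left_ae] with x hx using hx.mul_const _
    · refine (hgk.2.integral_norm_prod_right).mono' ?_ ?_
      · refine (StronglyMeasurable.integral_prod_left
          (f := fun r x => ‖(k (r, x) : ℝ) * h x‖) ?_).aestronglyMeasurable
        exact hm.norm.stronglyMeasurable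
      · filter_upwards [hDn] with x hx
        have e : ∫ r in S, ‖(k (r, x) : ℝ) * h x‖ ∂ν = ‖n x‖ := by
          simp_rw [norm_mul, NNReal.norm_eq]
          rw [integral_mul_const, ← hx, norm_mul, Real.norm_of_nonneg (hD0 x)]
        rw [e, norm_norm]
        refine (norm_integral_le_integral_norm _).trans_eq ?_
        simp_rw [mul_comm (g _)]
  have hset : ∀ B : Set ℝ, MeasurableSet B → ∀ f : ℝ × ℝ → ℝ, Measurable f →
      Integrable f (mixedLaw ν S k) → ∫ ω in Y ⁻¹' B, f (T ω, Y ω) ∂P =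
        B.indicator 1 0 * ∫ r in Sᶜ, f (r, 0) ∂ν +
        ∫ x, B.indicator 1 x * ∫ r in S, (k (r, x) : ℝ) * f (r, x) ∂ν := by
    intro B hB f hf hfi
    have hE : MeasurableSet (Prod.snd ⁻¹' B : Set (ℝ × ℝ)) := measurable_snd hB
    have e : ∀ r x, (Prod.snd ⁻¹' B : Set (ℝ × ℝ)).indicator f (r, x) =
        B.indicator 1 x * f (r, x) := by
      intro r x
      by_cases hx : x ∈ B <;> simp [Set.indicator, hx]
    rw [← integral_indicator (hY hB)]
    have : (fun ω => (Y ⁻¹' B).indicator (fun ω => f (T ω, Y ω)) ω) =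
        fun ω => (Prod.snd ⁻¹' B : Set (ℝ × ℝ)).indicator f (T ω, Y ω) := by
      rfl
    rw [this, ← integral_map (φ := fun ω => (T ω, Y ω)) hTY.aemeasurable
      (hf.indicator hE).aestronglyMeasurable, hlaw,
      integral_mixedLaw hk (hf.indicator hE) (hfi.indicator hE)]
    simp_rw [e, mul_left_comm _ (B.indicator 1 _), integral_const_mul]
  have hhP : Integrable (fun ω => h (Y ω)) P := by
    rw [← hlaw, integrable_map_measure hhm2.aestronglyMeasurable hTY.aemeasurable] at hhμ
    exact hhμ
  symm
  refine ae_eq_condExp_of_forall_setIntegral_eq hY.comap_le hgi (fun s _ _ => hhP.integrableOn)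
    ?_ ?_
  · rintro _ ⟨B, hB, rfl⟩ -
    have h1 := hset B hB _ hhm2 hhμ
    have h2 := hset B hB _ hgm hgμ
    simp only at h1 h2
    change ∫ ω in Y ⁻¹' B, h (Y ω) ∂P = _
    rw [h1, h2]
    congr 1
    · congr 1
      rw [setIntegral_const, smul_eq_mul]
      simp only [hh, if_true, ha]
      by_cases h0 : ν.real Sᶜ = 0
      · have : ν Sᶜ = 0 := by simpa [measureReal_eq_zero_iff] using h0
        simp [h0, Measure.restrict_eq_zero.2 this]
      · field_simp
    · refine integral_congr_ae ?_
      filter_upwards [hDn] with x hx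
      rw [integral_mul_const]
      congr 1
      refine hx.trans ?_
      simp only [hn, mul_comm]
  · exact ((hhm.comp (comap_measurable Y)).stronglyMeasurable).aestronglyMeasurable

end MixedLaw

/-- If `τ` is independent of `Z`, the law of `(τ, G(τ, Z))` disintegrates as
`ℙ_τ(dr) ⊗ law(G(r, Z))`. -/
lemma map_prodMk_apply_of_indepFun {Ω Ω' : Type*} [MeasurableSpace Ω] [MeasurableSpace Ω']
    {P : Measure Ω} [IsProbabilityMeasure P] {τ : Ω → ℝ} {Z : Ω → Ω'}
    (hτ : Measurable τ) (hZ : Measurable Z) (hind : IndepFun τ Z P)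
    {G : ℝ → Ω' → ℝ} (hG : Measurable (Function.uncurry G))
    {E : Set (ℝ × ℝ)} (hE : MeasurableSet E) :
    P.map (fun ω => (τ ω, G (τ ω) (Z ω))) E
      = ∫⁻ r, P.map (fun ω => G r (Z ω)) (Prod.mk r ⁻¹' E) ∂(P.map τ) := by
  have hprod := (indepFun_iff_map_prod_eq_prod_map_map hτ.aemeasurable hZ.aemeasurable).1 hind
  have hH : Measurable fun z : ℝ × Ω' => (z.1, G z.1 z.2) := measurable_fst.prodMk hG
  have hsec : ∀ r, Measurable (G r) := fun r => hG.comp measurable_prodMk_left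
  have : IsProbabilityMeasure (P.map Z) := Measure.isProbabilityMeasure_map hZ.aemeasurable
  have hcomp : P.map (fun ω => (τ ω, G (τ ω) (Z ω))) =
      (P.map fun ω => (τ ω, Z ω)).map fun z => (z.1, G z.1 z.2) :=
    (Measure.map_map hH (hτ.prodMk hZ)).symm
  rw [hcomp, hprod, Measure.map_apply hH hE, Measure.prod_apply (hH hE)]
  refine lintegral_congr fun r => ?_
  have hr : P.map (fun ω => G r (Z ω)) = (P.map Z).map (G r) :=
    (Measure.map_map (hsec r) hZ).symm
  rw [hr, Measure.map_apply (hsec r) (measurable_prodMk_left hE)]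
  rfl

/-- Version of `map_prodMk_apply_of_indepFun` for a random function measurable with respect to a
σ-algebra independent of `τ`. -/
lemma map_prodMk_apply_of_indep {Ω : Type*} {m' m : MeasurableSpace Ω} {P : Measure Ω}
    [IsProbabilityMeasure P] (hm' : m' ≤ m) {τ : Ω → ℝ} (hτ : Measurable τ)
    (hind : Indep (MeasurableSpace.comap τ inferInstance) m' P) {G : ℝ → Ω → ℝ}
    (hG : Measurable[@Prod.instMeasurableSpace ℝ Ω _ m'] (Function.uncurry G))
    {E : Set (ℝ × ℝ)} (hE : MeasurableSet E) :
    P.map (fun ω => (τ ω, G (τ ω) ω)) E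
      = ∫⁻ r, P.map (G r) (Prod.mk r ⁻¹' E) ∂(P.map τ) := by
  have hif : @IndepFun Ω ℝ Ω m _ m' τ id P := by
    rw [@IndepFun_iff_Indep Ω ℝ Ω m _ m' τ id P, MeasurableSpace.comap_id]
    exact hind
  exact @map_prodMk_apply_of_indepFun Ω Ω m m' P _ τ id hτ (fun s hs => hm' s hs) hif G hG E hE

lemma mixedLaw_gaussian_apply {ν : Measure ℝ} [IsProbabilityMeasure ν] {S : Set ℝ}
    {v : ℝ → ℝ≥0} (hS : MeasurableSet S)
    (hk : Measurable fun z : ℝ × ℝ => (gaussianPDFReal 0 (v z.1) z.2).toNNReal)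
    {E : Set (ℝ × ℝ)} (hE : MeasurableSet E) (hv : ∀ r ∈ S, v r ≠ 0) :
    mixedLaw ν S (fun z => (gaussianPDFReal 0 (v z.1) z.2).toNNReal) E =
      ∫⁻ r in Sᶜ, Measure.dirac (0 : ℝ) (Prod.mk r ⁻¹' E) ∂ν +
      ∫⁻ r in S, gaussianReal 0 (v r) (Prod.mk r ⁻¹' E) ∂ν := by
  unfold mixedLaw
  rw [Measure.add_apply, Measure.prod_apply hE, withDensity_apply _ hE,
    ← lintegral_indicator hE, lintegral_prod _ (by
      exact (hk.coe_nnreal_ennreal.indicator hE).aemeasurable)]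
  congr 1
  refine setLIntegral_congr_fun hS fun r hr => ?_
  simp only
  rw [gaussianReal_apply _ (hv r hr), ← lintegral_indicator (measurable_prodMk_left hE)]
  rfl

section Gaussian

variable {Ω : Type*} [MeasurableSpace Ω] {P : Measure Ω}

lemma memLp_two_of_map_eq_gaussianReal {Z : Ω → ℝ} (hZ : Measurable Z) {v : ℝ≥0}
    (h : P.map Z = gaussianReal 0 v) : MemLp Z 2 P := by
  have := memLp_id_gaussianReal (μ := 0) (v := v) 2
  rw [← h] at this
  exact (memLp_map_measure_iff aestronglyMeasurable_id hZ.aemeasurable).1 this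

lemma integral_sq_of_map_eq_gaussianReal {Z : Ω → ℝ} (hZ : Measurable Z) {v : ℝ≥0}
    (h : P.map Z = gaussianReal 0 v) : ∫ ω, Z ω ^ 2 ∂P = v := by
  have h1 : ∫ x, x ^ 2 ∂(gaussianReal 0 v) = v := by
    rw [← variance_id_gaussianReal (μ := 0) (v := v), variance_eq_integral aemeasurable_id]
    simp
  rw [← h1, ← h, integral_map hZ.aemeasurable (by fun_prop)]

/-- A Gaussian combination `X - c Y` has the variance dictated by the covariances. -/
lemma map_sub_const_mul_eq_gaussianReal {X Y : Ω → ℝ} (hX : Measurable X) (hY : Measurable Y)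
    (hX2 : MemLp X 2 P) (hY2 : MemLp Y 2 P) {c : ℝ}
    (hG : ∃ v : ℝ≥0, P.map (fun ω => X ω - c * Y ω) = gaussianReal 0 v) :
    P.map (fun ω => X ω - c * Y ω) = gaussianReal 0
      (∫ ω, X ω * X ω ∂P - 2 * c * ∫ ω, X ω * Y ω ∂P + c ^ 2 * ∫ ω, Y ω * Y ω ∂P).toNNReal := by
  obtain ⟨v, hv⟩ := hG
  have hsq := integral_sq_of_map_eq_gaussianReal (by fun_prop) hv
  have hXX := hX2.integrable_mul hX2
  have hXY := hX2.integrable_mul hY2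
  have hYY := hY2.integrable_mul hY2
  rw [hv]
  congr 1
  rw [← Real.toNNReal_coe (r := v), ← hsq]
  congr 1
  have e : (fun ω => (X ω - c * Y ω) ^ 2) = fun ω =>
      (X ω * X ω - 2 * c * (X ω * Y ω)) + c ^ 2 * (Y ω * Y ω) := by
    ext ω; ring
  have hXX' : Integrable (fun ω => X ω * X ω) P := hXX
  have hXY' : Integrable (fun ω => X ω * Y ω) P := hXY
  have hYY' : Integrable (fun ω => Y ω * Y ω) P := hYY
  rw [e, integral_add (f := fun ω => X ω * X ω - 2 * c * (X ω * Y ω))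
      (hXX'.sub (hXY'.const_mul _)) (hYY'.const_mul _),
    integral_sub hXX' (hXY'.const_mul _), integral_const_mul, integral_const_mul]

end Gaussian

/-- A process with continuous paths on `[0, ∞)`, evaluated at a time `max r t ≥ 0`, is jointly
measurable. -/
lemma measurable_uncurry_max {Ω : Type*} {m : MeasurableSpace Ω} {X : ℝ → Ω → ℝ}
    (hX : ∀ t, 0 ≤ t → Measurable (X t))
    (hXcont : ∀ ω, ContinuousOn (fun t => X t ω) (Set.Ici 0)) {t : ℝ} (ht : 0 ≤ t) :
    Measurable (Function.uncurry fun r ω => X (max r t) ω) := by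
  refine measurable_uncurry_of_continuous_of_measurable (fun ω => ?_)
    fun r => hX _ (ht.trans (le_max_right _ _))
  exact (hXcont ω).comp_continuous (by fun_prop) fun r => ht.trans (le_max_right r t)

/-- Bayes estimate: for t > 0 with F(t) > 0 and E[|g(τ)|] < ∞,
E[g(τ) | σ(ξ_t)] = (1/F(t)) ∫_{(0,t]} g dℙ_τ · 1_{ξ_t = 0}
  + ∫_{(t,∞)} g(r) ϕ_{ξ^r_t}(ξ_t) ℙ_τ(dr) · 1_{ξ_t ≠ 0}  ℙ-a.s. -/
theorem stmt_4
    {Ω : Type*} [MeasurableSpace Ω] (P : Measure Ω) [IsProbabilityMeasure P]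
    (X : ℝ → Ω → ℝ)
    (hXmeas : ∀ t, Measurable (X t))
    (hGauss : ∀ (m : ℕ) (ts : Fin m → ℝ), (∀ i, 0 ≤ ts i) → ∀ c : Fin m → ℝ,
      ∃ v : NNReal, Measure.map (fun ω => ∑ i, c i * X (ts i) ω) P = gaussianReal 0 v)
    (hXcont : ∀ ω, ContinuousOn (fun t => X t ω) (Set.Ici 0))
    (hX0 : ∀ᵐ ω ∂P, X 0 ω = 0)
    (R : ℝ → ℝ → ℝ)
    (hR : ∀ s t, R s t = ∫ ω, X s ω * X t ω ∂P)
    (hRpos : ∀ t, 0 < t → 0 < R t t)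
    (hRnd : ∀ s t, 0 < s → 0 < t → s ≠ t → (R s t)^2 < R s s * R t t)
    (ξr : ℝ → ℝ → Ω → ℝ)
    (hξr : ∀ r t ω, ξr r t ω = X t ω - R t (max r t) / R (max r t) (max r t) * X (max r t) ω)
    (τ : Ω → ℝ) (hτmeas : Measurable τ) (hτpos : ∀ ω, 0 < τ ω)
    (hindep : Indep (MeasurableSpace.comap τ inferInstance)
      (⨆ t ∈ Set.Ici (0:ℝ), MeasurableSpace.comap (X t) inferInstance) P)
    (F : ℝ → ℝ) (hF : ∀ t, F t = (P {ω | τ ω ≤ t}).toReal)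
    (ξ : ℝ → Ω → ℝ) (hξ : ∀ t ω, ξ t ω = ξr (τ ω) t ω)
    (p : ℝ → ℝ → ℝ → ℝ)
    (hp : ∀ v x y, 0 < v →
      p v x y = (Real.sqrt (2 * Real.pi * v))⁻¹ * Real.exp (-(x - y)^2 / (2*v)))
    (A : ℝ → ℝ → ℝ) (hA : ∀ t s, A t s = R s s * R t t - R s t ^ 2)
    (φ : ℝ → ℝ → ℝ → ℝ) (hφ : ∀ t r x, 0 < t → t < r → φ t r x = p (A t r / R r r) x 0)
    (ϕ : ℝ → ℝ → ℝ → ℝ)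
    (hϕ : ∀ t r x, 0 < t → t < r →
      ϕ t r x = φ t r x / ∫ s in Set.Ioi t, φ t s x ∂(Measure.map τ P))
    (t : ℝ) (ht : 0 < t) (hFt : 0 < F t)
    (g : ℝ → ℝ) (hgmeas : Measurable g) (hgint : Integrable (fun ω => g (τ ω)) P) :
    P[(fun ω => g (τ ω))|MeasurableSpace.comap (ξ t) inferInstance] =ᵐ[P]
      fun ω => (∫ r in Set.Ioc (0:ℝ) t, g r ∂(Measure.map τ P)) / F t *
          (if ξ t ω = 0 then 1 else 0)
        + (∫ r in Set.Ioi t, g r * ϕ t r (ξ t ω) ∂(Measure.map τ P)) *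
          (if ξ t ω ≠ 0 then 1 else 0) := by
  have hXL2 : ∀ s, 0 ≤ s → MemLp (X s) 2 P := by
    intro s hs
    obtain ⟨v, hv⟩ := hGauss 1 (fun _ => s) (fun _ => hs) (fun _ => 1)
    refine memLp_two_of_map_eq_gaussianReal (hXmeas s) (v := v) ?_
    simpa using hv
  have hRsymm : ∀ s u, R s u = R u s := fun s u => by simp_rw [hR, mul_comm]
  set v : ℝ → ℝ≥0 := fun r =>
    (A t (max r t) / R (max r t) (max r t)).toNNReal with hv_def
  have hXmax : Measurable (Function.uncurry fun r ω => X (max r t) ω) :=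
    measurable_uncurry_max (fun s _ => hXmeas s) hXcont ht.le
  have hRmax : Measurable fun r => R t (max r t) := by
    simp_rw [hR]
    apply StronglyMeasurable.measurable
    apply StronglyMeasurable.integral_prod_right (f := fun r ω => X t ω * X (max r t) ω)
    exact (((hXmeas t).comp measurable_snd).mul hXmax).stronglyMeasurable
  have hRmm : Measurable fun r => R (max r t) (max r t) := by
    simp_rw [hR]
    apply StronglyMeasurable.measurable
    apply StronglyMeasurable.integral_prod_right (f := fun r ω => X (max r t) ω * X (max r t) ω)
    exact (hXmax.mul hXmax).stronglyMeasurable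
  have hvm : Measurable v := by
    simp_rw [hv_def, hA, hRsymm _ t]
    exact (((hRmm.mul measurable_const).sub (hRmax.pow_const 2)).div hRmm).real_toNNReal
  have hvr : ∀ r, t < r → 0 < A t r / R r r := by
    intro r hr
    have h0 := ht.trans hr
    rw [hA]
    exact div_pos (sub_pos.2 (hRnd r t h0 ht hr.ne')) (hRpos r h0)
  have hvS : ∀ r, t < r → v r = (A t r / R r r).toNNReal := fun r hr => by
    simp only [hv_def, max_eq_left hr.le]
  have hv0 : ∀ r ∈ Ioi t, v r ≠ 0 := fun r hr => by
    rw [hvS r hr]; exact (Real.toNNReal_pos.2 (hvr r hr)).ne'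
  set k : ℝ × ℝ → ℝ≥0 := fun z => (gaussianPDFReal 0 (v z.1) z.2).toNNReal with hk_def
  have hkm : Measurable k := by
    refine Measurable.real_toNNReal ?_
    unfold gaussianPDFReal
    have h1 : Measurable fun z : ℝ × ℝ => (v z.1 : ℝ) := (hvm.comp measurable_fst).coe_nnreal_real
    fun_prop
  have hkφ : ∀ r x, t < r → (k (r, x) : ℝ) = φ t r x := by
    intro r x hr
    rw [hφ t r x ht hr, hp _ _ _ (hvr r hr)]
    simp only [hk_def]
    rw [Real.coe_toNNReal _ (gaussianPDFReal_nonneg _ _ _), gaussianPDFReal, hvS r hr,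
      Real.coe_toNNReal _ (hvr r hr).le]
  have : IsProbabilityMeasure (P.map τ) := Measure.isProbabilityMeasure_map hτmeas.aemeasurable
  have hmX_le : (⨆ t ∈ Set.Ici (0:ℝ), MeasurableSpace.comap (X t) inferInstance)
      ≤ ‹MeasurableSpace Ω› :=
    iSup₂_le fun s _ => (hXmeas s).comap_le
  have hXmX : ∀ s, 0 ≤ s →
      Measurable[⨆ t ∈ Set.Ici (0:ℝ), MeasurableSpace.comap (X t) inferInstance] (X s) := fun s hs =>
    Measurable.mono (comap_measurable (X s))
      (le_iSup₂_of_le (f := fun s (_ : s ∈ Set.Ici (0:ℝ)) =>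
        MeasurableSpace.comap (X s) inferInstance) s hs le_rfl) le_rfl
  have hξm : ∀ m : MeasurableSpace Ω, (∀ s, 0 ≤ s → Measurable[m] (X s)) →
      Measurable (Function.uncurry fun r ω => ξr r t ω) := by
    intro m hm
    have h1 : Measurable (Function.uncurry fun r ω => X (max r t) ω) :=
      measurable_uncurry_max hm hXcont ht.le
    have h2 : Measurable (X t) := hm t ht.le
    have e : (Function.uncurry fun r ω => ξr r t ω) = fun z : ℝ × Ω =>
        X t z.2 - R t (max z.1 t) / R (max z.1 t) (max z.1 t) * X (max z.1 t) z.2 := by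
      ext z; exact hξr _ _ _
    rw [e]
    exact (h2.comp measurable_snd).sub
      (((hRmax.div hRmm).comp measurable_fst).mul h1)
  have hξt : Measurable (ξ t) := by
    have e : ξ t = fun ω => (Function.uncurry fun r ω => ξr r t ω) (τ ω, ω) := by
      ext ω; exact hξ t ω
    rw [e]
    exact (hξm _ fun s _ => hXmeas s).comp (hτmeas.prodMk measurable_id)
  have hmap_le : ∀ r ∈ (Ioi t)ᶜ, P.map (fun ω => ξr r t ω) = Measure.dirac 0 := by
    intro r hr
    have hr' : r ≤ t := by simpa using hr
    have e : (fun ω => ξr r t ω) = fun _ => 0 := by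
      ext ω
      rw [hξr, max_eq_right hr', div_self (hRpos t ht).ne', one_mul, sub_self]
    rw [e, Measure.map_const]
    simp
  have hmap_gt : ∀ r ∈ Ioi t, P.map (fun ω => ξr r t ω) = gaussianReal 0 (v r) := by
    intro r hr
    have hr' : t < r := hr
    have h0 : 0 < r := ht.trans hr'
    have e : (fun ω => ξr r t ω) = fun ω => X t ω - R t r / R r r * X r ω := by
      ext ω
      rw [hξr, max_eq_left hr'.le]
    rw [e, map_sub_const_mul_eq_gaussianReal (hXmeas t) (hXmeas r) (hXL2 t ht.le)
      (hXL2 r h0.le), hvS r hr', ← hR, ← hR, ← hR, hA, hRsymm r t]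
    · congr 2
      have := (hRpos r h0).ne'
      field_simp
      ring
    · obtain ⟨w, hw⟩ := hGauss 2 ![t, r] (by
        intro i; fin_cases i
        · exact ht.le
        · exact h0.le) ![1, -(R t r / R r r)]
      refine ⟨w, ?_⟩
      rw [← hw]
      congr 1
      ext ω
      simp [Fin.sum_univ_two, sub_eq_add_neg]
  have hlaw : P.map (fun ω => (τ ω, ξ t ω)) = mixedLaw (P.map τ) (Ioi t) k := by
    ext E hE
    have h1 := map_prodMk_apply_of_indep hmX_le hτmeas hindep (hξm _ hXmX) hE
    simp_rw [hξ]
    rw [h1, mixedLaw_gaussian_apply measurableSet_Ioi hkm hE hv0, add_comm,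
      ← lintegral_add_compl _ measurableSet_Ioi]
    congr 1
    · exact setLIntegral_congr_fun measurableSet_Ioi fun r hr => by simp only [hmap_gt r hr]
    · exact setLIntegral_congr_fun measurableSet_Ioi.compl fun r hr => by
        simp only [hmap_le r hr]
  have hF' : F t = (P.map τ).real (Ioi t)ᶜ := by
    rw [hF, measureReal_def, compl_Ioi, Measure.map_apply hτmeas measurableSet_Iic]
    rfl
  have hIoc : ∫ r in Set.Ioc (0:ℝ) t, g r ∂(P.map τ) = ∫ r in (Ioi t)ᶜ, g r ∂(P.map τ) := by
    have hpos : ∀ᵐ r ∂(P.map τ), 0 < r := by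
      rw [ae_map_iff hτmeas.aemeasurable measurableSet_Ioi]
      exact Filter.Eventually.of_forall hτpos
    refine setIntegral_congr_set ?_
    filter_upwards [hpos] with r hr
    apply propext
    change r ∈ Set.Ioc (0:ℝ) t ↔ r ∈ (Ioi t)ᶜ
    simp [hr]
  refine (condExp_comp_of_map_eq_mixedLaw hτmeas hξt hkm hlaw hgmeas
    hgint).trans (Filter.Eventually.of_forall fun ω => ?_)
  simp only
  rw [hIoc, hF']
  by_cases h0 : ξ t ω = 0
  · simp [h0]
  · simp only [h0, if_false, mul_zero, zero_add, ne_eq, not_false_eq_true, if_true, mul_one]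
    rw [← integral_div]
    refine setIntegral_congr_fun measurableSet_Ioi fun r hr => ?_
    rw [hϕ t r _ ht hr, hkφ r _ hr, mul_div_assoc,
      setIntegral_congr_fun measurableSet_Ioi fun s hs => hkφ s (ξ t ω) hs]
end

section
/- Let 0 < t < u with F(t) > 0 and let g : ℝ → ℝ be bounded measurable. Then ℙ-a.s., E[g(ξ_u) | σ(ξ_t)] = g(0) (1_{{ξ_t = 0}} + ∫_{(t,u]} ϕ_{ξ^r_t}(ξ_t) ℙ_τ(dr) · 1_{{ξ_t ≠ 0}}) + ∫_{(u,∞)} (∫_ℝ g(y) p(σ^r_{t,u}, y, μ^r_{t,u} ξ_t) dy) ϕ_{ξ^r_t}(ξ_t) ℙ_τ(dr) · 1_{{ξ_t ≠ 0}}. -/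
open MeasureTheory ProbabilityTheory Real Set

theorem indicator_apply_eq_of_mem_iff {α β M : Type*} [Zero M] {s : Set α} {s' : Set β}
    {f : α → M} {f' : β → M} {a : α} {b : β} (h : a ∈ s ↔ b ∈ s') (hf : f a = f' b) :
    s.indicator f a = s'.indicator f' b := by
  by_cases ha : a ∈ s
  · rw [indicator_of_mem ha, indicator_of_mem (h.1 ha), hf]
  · rw [indicator_of_notMem ha, indicator_of_notMem (mt h.2 ha)]

theorem lintegral_comp_prodMk_of_indepFun {Ω Ω' E : Type*} [MeasurableSpace Ω]
    [MeasurableSpace Ω'] [MeasurableSpace E] {P : Measure Ω} [IsProbabilityMeasure P]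
    {T : Ω → E} {Y : Ω → Ω'} (hT : Measurable T) (hY : Measurable Y) (h : IndepFun T Y P)
    {f : E × Ω' → ENNReal} (hf : Measurable f) :
    ∫⁻ ω, f (T ω, Y ω) ∂P = ∫⁻ r, ∫⁻ ω, f (r, Y ω) ∂P ∂(P.map T) := by
  have := Measure.isProbabilityMeasure_map (μ := P) hY.aemeasurable
  have := Measure.isProbabilityMeasure_map (μ := P) hT.aemeasurable
  have hmap := (indepFun_iff_map_prod_eq_prod_map_map hT.aemeasurable hY.aemeasurable).1 h
  rw [← lintegral_map (f := f) hf (hT.prodMk hY), hmap, lintegral_prod _ hf.aemeasurable]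
  exact lintegral_congr fun r => lintegral_map (hf.comp measurable_prodMk_left) hY

theorem integral_comp_prodMk_of_indepFun {Ω Ω' E : Type*} [MeasurableSpace Ω]
    [MeasurableSpace Ω'] [MeasurableSpace E] {P : Measure Ω} [IsProbabilityMeasure P]
    {T : Ω → E} {Y : Ω → Ω'} (hT : Measurable T) (hY : Measurable Y) (h : IndepFun T Y P)
    {f : E × Ω' → ℝ} (hf : Measurable f) {C : ℝ} (hC : ∀ z, |f z| ≤ C) :
    ∫ ω, f (T ω, Y ω) ∂P = ∫ r, ∫ ω, f (r, Y ω) ∂P ∂(P.map T) := by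
  have := Measure.isProbabilityMeasure_map (μ := P) hY.aemeasurable
  have := Measure.isProbabilityMeasure_map (μ := P) hT.aemeasurable
  have hmap := (indepFun_iff_map_prod_eq_prod_map_map hT.aemeasurable hY.aemeasurable).1 h
  rw [← integral_map (f := f) (hT.prodMk hY).aemeasurable hf.aestronglyMeasurable, hmap,
    integral_prod _ (Integrable.of_bound hf.aestronglyMeasurable C (ae_of_all _ hC))]
  exact integral_congr_ae (ae_of_all _ fun r => integral_map hY.aemeasurable
    (hf.comp measurable_prodMk_left).aestronglyMeasurable)

/-- **Bayes' formula** for a mixture: conditionally on an independent random time `τ = r`, the pair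
`(V, W)` vanishes if `r ≤ t`, while for `t < r` the variable `V` has density `φ r` and
`g W` has conditional expectation `K r` given `V`. -/
theorem condExp_eq_of_mixture {Ω Ω' : Type*} [MeasurableSpace Ω] [MeasurableSpace Ω']
    {P : Measure Ω} [IsProbabilityMeasure P] {τ : Ω → ℝ} {Y : Ω → Ω'} (hτ : Measurable τ)
    (hY : Measurable Y) (hind : IndepFun τ Y P) {V W : ℝ × Ω' → ℝ} (hV : Measurable V)
    (hW : Measurable W) {g : ℝ → ℝ} (hg : Measurable g) {C : ℝ} (hgC : ∀ x, |g x| ≤ C) {t : ℝ}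
    {φ K : ℝ → ℝ → ℝ} (hφ : Measurable (Function.uncurry φ)) (hK : Measurable (Function.uncurry K))
    (hφ0 : ∀ r x, 0 ≤ φ r x) (hKC : ∀ r x, |K r x| ≤ C)
    (hzero : ∀ r ≤ t, ∀ ω, V (r, Y ω) = 0 ∧ W (r, Y ω) = 0)
    (hlaw : ∀ r, t < r →
      P.map (fun ω => V (r, Y ω)) = volume.withDensity fun x => ENNReal.ofReal (φ r x))
    (hcond : ∀ r, t < r → ∀ B, MeasurableSet B →
      ∫ ω in (fun ω => V (r, Y ω)) ⁻¹' B, g (W (r, Y ω)) ∂P = ∫ x in B, K r x * φ r x) :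
    P[fun ω => g (W (τ ω, Y ω)) | MeasurableSpace.comap (fun ω => V (τ ω, Y ω)) inferInstance] =ᵐ[P]
      fun ω => if V (τ ω, Y ω) = 0 then g 0 else
        (∫ r in Ioi t, K r (V (τ ω, Y ω)) * φ r (V (τ ω, Y ω)) ∂(P.map τ)) /
          ∫ r in Ioi t, φ r (V (τ ω, Y ω)) ∂(P.map τ) := by
  have := Measure.isProbabilityMeasure_map (μ := P) hτ.aemeasurable
  set ν := (P.map τ).restrict (Ioi t) with hν
  set N : ℝ → ℝ := fun x => ∫ r, K r x * φ r x ∂ν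
  set D : ℝ → ℝ := fun x => ∫ r, φ r x ∂ν
  set H : ℝ → ℝ := fun x => if x = 0 then g 0 else N x / D x
  have hC : 0 ≤ C := (abs_nonneg _).trans (hgC 0)
  have hKφ : Measurable (Function.uncurry fun r x => K r x * φ r x) := hK.mul hφ
  have hNm : Measurable N :=
    hKφ.stronglyMeasurable.integral_prod_left.measurable
  have hDm : Measurable D :=
    hφ.stronglyMeasurable.integral_prod_left.measurable
  have hHm : Measurable H :=
    Measurable.ite (measurableSet_singleton 0) measurable_const (hNm.div hDm)
  have hD0 : ∀ x, 0 ≤ D x := fun x => integral_nonneg fun r => hφ0 r x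
  have hbd : ∀ r x, |K r x * φ r x| ≤ C * φ r x := fun r x => by
    rw [abs_mul, abs_of_nonneg (hφ0 r x)]
    exact mul_le_mul_of_nonneg_right (hKC r x) (hφ0 r x)
  have hND : ∀ x, Integrable (fun r => φ r x) ν → |N x| ≤ C * D x := fun x hx => by
    rw [← integral_const_mul]
    exact norm_integral_le_of_norm_le (f := fun r => K r x * φ r x) (hx.const_mul C)
      (ae_of_all _ fun r => hbd r x)
  have hHC : ∀ x, |H x| ≤ C := by
    intro x
    by_cases hx : x = 0
    · simp only [H, hx, if_true]; exact hgC 0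
    · simp only [H, hx, if_false]
      by_cases hi : Integrable (fun r => φ r x) ν
      · rw [abs_div, abs_of_nonneg (hD0 x)]
        exact div_le_of_le_mul₀ (hD0 x) hC (hND x hi)
      · simp only [D, integral_undef hi, div_zero, abs_zero, hC]
  have hVτ : Measurable fun ω => V (τ ω, Y ω) := hV.comp (hτ.prodMk hY)
  have hWτ : Measurable fun ω => W (τ ω, Y ω) := hW.comp (hτ.prodMk hY)
  have hprob : ∀ r, t < r → ∫⁻ x, ENNReal.ofReal (φ r x) = 1 := fun r hr => by
    have h := congrArg (fun μ => μ univ) (hlaw r hr)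
    have h1 := Measure.isProbabilityMeasure_map (μ := P) (f := fun ω => V (r, Y ω))
      (hV.comp (measurable_const.prodMk hY)).aemeasurable
    simpa using h.symm
  have hφint : Integrable (Function.uncurry φ) (ν.prod volume) := by
    refine ⟨hφ.aestronglyMeasurable, ?_⟩
    have hφ0' : 0 ≤ᵐ[ν.prod volume] Function.uncurry φ := ae_of_all _ fun z => hφ0 z.1 z.2
    rw [hasFiniteIntegral_iff_ofReal hφ0',
      lintegral_prod _ hφ.ennreal_ofReal.aemeasurable]
    have : ∫⁻ r, ∫⁻ x, ENNReal.ofReal (Function.uncurry φ (r, x)) ∂volume ∂ν = ∫⁻ r, 1 ∂ν :=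
      setLIntegral_congr_fun measurableSet_Ioi fun r hr => hprob r hr
    rw [this]
    simp
  have hKφint : Integrable (Function.uncurry fun r x => K r x * φ r x) (ν.prod volume) :=
    (hφint.const_mul C).mono' hKφ.aestronglyMeasurable (ae_of_all _ fun z => hbd z.1 z.2)
  have hint : ∀ᵐ x : ℝ, Integrable (fun r => φ r x) ν := hφint.prod_left_ae
  have hmapV : (P.restrict (τ ⁻¹' Ioi t)).map (fun ω => V (τ ω, Y ω)) =
      volume.withDensity fun x => ENNReal.ofReal (D x) := by
    ext B hB
    rw [Measure.map_apply hVτ hB, Measure.restrict_apply (hVτ hB), withDensity_apply _ hB]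
    have hS : MeasurableSet {z : ℝ × Ω' | t < z.1 ∧ V z ∈ B} :=
      (measurable_fst measurableSet_Ioi).inter (hV hB)
    calc P ((fun ω => V (τ ω, Y ω)) ⁻¹' B ∩ τ ⁻¹' Ioi t)
        = ∫⁻ ω, indicator {z : ℝ × Ω' | t < z.1 ∧ V z ∈ B} 1 (τ ω, Y ω) ∂P := by
          rw [← lintegral_indicator_one ((hVτ hB).inter (hτ measurableSet_Ioi))]
          refine lintegral_congr fun ω => ?_
          exact indicator_apply_eq_of_mem_iff and_comm rfl
      _ = ∫⁻ r, ∫⁻ ω, indicator {z : ℝ × Ω' | t < z.1 ∧ V z ∈ B} 1 (r, Y ω) ∂P ∂(P.map τ) :=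
          lintegral_comp_prodMk_of_indepFun hτ hY hind (measurable_one.indicator hS)
      _ = ∫⁻ r, ∫⁻ x in B, ENNReal.ofReal (φ r x) ∂volume ∂ν := by
          rw [hν, ← lintegral_indicator measurableSet_Ioi]
          refine lintegral_congr fun r => ?_
          have hVr : Measurable fun ω => V (r, Y ω) := hV.comp (measurable_const.prodMk hY)
          by_cases hr : t < r
          · rw [indicator_of_mem (by exact hr), ← withDensity_apply _ hB, ← hlaw r hr,
              Measure.map_apply hVr hB, ← lintegral_indicator_one (hVr hB)]
            refine lintegral_congr fun ω => ?_
            exact indicator_apply_eq_of_mem_iff (and_iff_right hr) rfl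
          · rw [indicator_of_notMem (by exact hr)]
            simp [indicator, hr]
      _ = ∫⁻ x in B, ∫⁻ r, ENNReal.ofReal (φ r x) ∂ν :=
          lintegral_lintegral_swap hφ.ennreal_ofReal.aemeasurable
      _ = ∫⁻ x in B, ENNReal.ofReal (D x) := by
          refine lintegral_congr_ae (ae_restrict_of_ae ?_)
          filter_upwards [hint] with x hx
          exact (ofReal_integral_eq_lintegral_ofReal hx (ae_of_all _ fun r => hφ0 r x)).symm
  have hND_mul : ∀ᵐ x : ℝ, D x * H x = N x := by
    filter_upwards [hint, (measure_singleton (0 : ℝ) : volume {(0 : ℝ)} = 0) |>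
      measure_eq_zero_iff_ae_notMem.1] with x hx hx0
    have hx0 : x ≠ 0 := hx0
    simp only [H, hx0, if_false]
    by_cases hD : D x = 0
    · have := hND x hx
      rw [hD, mul_zero] at this
      rw [hD, zero_mul, abs_nonpos_iff.1 this]
    · field_simp
  refine (ae_eq_condExp_of_forall_setIntegral_eq (g := fun ω => H (V (τ ω, Y ω)))
    hVτ.comap_le ?_ ?_ ?_ ?_).symm
  · exact Integrable.of_bound (hg.comp hWτ).aestronglyMeasurable C (ae_of_all _ fun ω => hgC _)
  · intro s _ _
    exact (Integrable.of_bound (hHm.comp hVτ).aestronglyMeasurable C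
      (ae_of_all _ fun ω => hHC _)).integrableOn
  · rintro s ⟨B, hB, rfl⟩ -
    have hHi : Integrable (fun ω => H (V (τ ω, Y ω))) P :=
      Integrable.of_bound (hHm.comp hVτ).aestronglyMeasurable C (ae_of_all _ fun ω => hHC _)
    have hgi : Integrable (fun ω => g (W (τ ω, Y ω))) P :=
      Integrable.of_bound (hg.comp hWτ).aestronglyMeasurable C (ae_of_all _ fun ω => hgC _)
    have hT : MeasurableSet (τ ⁻¹' Ioi t) := hτ measurableSet_Ioi
    rw [← integral_inter_add_sdiff hT hHi.integrableOn,
      ← integral_inter_add_sdiff hT hgi.integrableOn]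
    congr 1
    · trans ∫ x in B, N x
      · rw [← Measure.restrict_restrict (hVτ hB), ← setIntegral_map hB
          (hHm.aestronglyMeasurable) hVτ.aemeasurable, hmapV,
          setIntegral_withDensity_eq_setIntegral_toReal_smul hDm.ennreal_ofReal
            (ae_of_all _ fun x => ENNReal.ofReal_lt_top) _ hB]
        refine integral_congr_ae (ae_restrict_of_ae ?_)
        filter_upwards [hND_mul] with x hx
        rw [ENNReal.toReal_ofReal (hD0 x), smul_eq_mul, hx]
      · have hS : MeasurableSet {z : ℝ × Ω' | t < z.1 ∧ V z ∈ B} :=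
          (measurable_fst measurableSet_Ioi).inter (hV hB)
        have hind' := integral_comp_prodMk_of_indepFun hτ hY hind
          ((hg.comp hW).indicator hS) (C := C) fun z => by
            by_cases hz : z ∈ {z : ℝ × Ω' | t < z.1 ∧ V z ∈ B}
            · rw [indicator_of_mem hz]; exact hgC _
            · rw [indicator_of_notMem hz, abs_zero]; exact hC
        symm
        calc ∫ ω in (fun ω => V (τ ω, Y ω)) ⁻¹' B ∩ τ ⁻¹' Ioi t, g (W (τ ω, Y ω)) ∂P
            = ∫ ω, indicator {z : ℝ × Ω' | t < z.1 ∧ V z ∈ B} (g ∘ W) (τ ω, Y ω) ∂P := by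
              rw [← integral_indicator ((hVτ hB).inter hT)]
              refine integral_congr_ae (ae_of_all _ fun ω => ?_)
              exact indicator_apply_eq_of_mem_iff and_comm rfl
          _ = _ := hind'
          _ = ∫ r, ∫ x in B, K r x * φ r x ∂volume ∂ν := by
              rw [hν, ← integral_indicator measurableSet_Ioi]
              refine integral_congr_ae (ae_of_all _ fun r => ?_)
              have hVr : Measurable fun ω => V (r, Y ω) := hV.comp (measurable_const.prodMk hY)
              by_cases hr : t < r
              · dsimp only
                rw [indicator_of_mem (by exact hr), ← hcond r hr B hB,
                  ← integral_indicator (hVr hB)]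
                refine integral_congr_ae (ae_of_all _ fun ω => ?_)
                exact indicator_apply_eq_of_mem_iff (and_iff_right hr) rfl
              · dsimp only
                rw [indicator_of_notMem (by exact hr)]
                simp [indicator, hr]
          _ = ∫ x in B, N x := by
              refine integral_integral_swap (f := fun r x => K r x * φ r x) (μ := ν)
                (ν := volume.restrict B) ?_
              rw [← Measure.restrict_univ (μ := ν), Measure.prod_restrict]
              exact hKφint.integrableOn
    · refine setIntegral_congr_fun ((hVτ hB).diff hT) fun ω hω => ?_
      have h := hzero (τ ω) (not_lt.1 hω.2) ω
      simp only [h.1, h.2, H, if_true]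
  · exact (hHm.comp (comap_measurable _)).stronglyMeasurable.aestronglyMeasurable

theorem hasGaussianLaw_prodMk_of_linearComb {Ω : Type*} [MeasurableSpace Ω] {P : Measure Ω}
    {V W : Ω → ℝ} (hV : Measurable V) (hW : Measurable W)
    (h : ∀ a b : ℝ, ∃ v : NNReal, P.map (fun ω => a * V ω + b * W ω) = gaussianReal 0 v) :
    HasGaussianLaw (fun ω => (V ω, W ω)) P := by
  refine ⟨isGaussian_of_map_eq_gaussianReal fun L => ?_⟩
  obtain ⟨v, hv⟩ := h (L (1, 0)) (L (0, 1))
  refine ⟨0, v, ?_⟩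
  rw [Measure.map_map (by fun_prop) (hV.prodMk hW), ← hv]
  congr 1
  ext ω
  have : (V ω, W ω) = V ω • ((1 : ℝ), (0 : ℝ)) + W ω • ((0 : ℝ), (1 : ℝ)) := by simp
  simp only [Function.comp_apply]
  rw [this, map_add, map_smul, map_smul, smul_eq_mul, smul_eq_mul, mul_comm, mul_comm (W ω)]

theorem memLp_two_of_map_eq_gaussianReal_s5 {Ω : Type*} [MeasurableSpace Ω] {P : Measure Ω}
    {V : Ω → ℝ} (hV : Measurable V) {m : ℝ} {v : NNReal} (h : P.map V = gaussianReal m v) :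
    MemLp V 2 P := by
  have : MemLp id 2 (P.map V) := h ▸ memLp_id_gaussianReal 2
  exact (memLp_map_measure_iff aestronglyMeasurable_id hV.aemeasurable).1 this

theorem integral_eq_zero_of_map_eq_gaussianReal {Ω : Type*} [MeasurableSpace Ω] {P : Measure Ω}
    {V : Ω → ℝ} (hV : Measurable V) {v : NNReal} (h : P.map V = gaussianReal 0 v) :
    ∫ ω, V ω ∂P = 0 := by
  rw [← integral_map (f := fun x => x) hV.aemeasurable (by fun_prop), h, integral_id_gaussianReal]

theorem map_eq_gaussianReal_integral_sq {Ω : Type*} [MeasurableSpace Ω] {P : Measure Ω}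
    {V : Ω → ℝ} (hV : Measurable V) (h : ∃ v : NNReal, P.map V = gaussianReal 0 v) :
    P.map V = gaussianReal 0 (∫ ω, V ω ^ 2 ∂P).toNNReal := by
  obtain ⟨v, hv⟩ := h
  have h2 : ∫ ω, V ω ^ 2 ∂P = v := by
    rw [← integral_map (f := fun x => x ^ 2) hV.aemeasurable (by fun_prop), hv]
    have := variance_id_gaussianReal (μ := 0) (v := v)
    rw [variance_of_integral_eq_zero (by fun_prop) (by simp)] at this
    simpa using this
  rw [h2, Real.toNNReal_coe, hv]

theorem setIntegral_comp_of_jointly_gaussian {Ω : Type*} [MeasurableSpace Ω] {P : Measure Ω}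
    [IsProbabilityMeasure P] {V W : Ω → ℝ} (hV : Measurable V) (hW : Measurable W)
    (h : ∀ a b : ℝ, ∃ v : NNReal, P.map (fun ω => a * V ω + b * W ω) = gaussianReal 0 v)
    {v c w : ℝ} (hv : ∫ ω, V ω ^ 2 ∂P = v) (hc : ∫ ω, V ω * W ω ∂P = c)
    (hw : ∫ ω, W ω ^ 2 ∂P = w) (hv0 : 0 < v) (hσ : 0 < w - c ^ 2 / v)
    {g : ℝ → ℝ} (hg : Measurable g) {C : ℝ} (hgC : ∀ x, |g x| ≤ C) {B : Set ℝ}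
    (hB : MeasurableSet B) :
    ∫ ω in V ⁻¹' B, g (W ω) ∂P =
      ∫ x in B, (∫ y, g y * gaussianPDFReal (c / v * x) (w - c ^ 2 / v).toNNReal y) *
        gaussianPDFReal 0 v.toNNReal x := by
  set b := c / v
  set Z : Ω → ℝ := fun ω => W ω - b * V ω with hZ
  have hZm : Measurable Z := hW.sub (hV.const_mul b)
  have hVZ : ∀ a d : ℝ, ∃ s : NNReal, P.map (fun ω => a * V ω + d * Z ω) = gaussianReal 0 s := by
    intro a d
    obtain ⟨s, hs⟩ := h (a - d * b) d
    refine ⟨s, hs ▸ ?_⟩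
    congr 1
    ext ω
    simp only [hZ]
    ring
  have hVg : ∃ s : NNReal, P.map V = gaussianReal 0 s := by simpa using h 1 0
  have hWg : ∃ s : NNReal, P.map W = gaussianReal 0 s := by simpa using h 0 1
  have hZg : ∃ s : NNReal, P.map Z = gaussianReal 0 s := by simpa using hVZ 0 1
  have hV2 : MemLp V 2 P := memLp_two_of_map_eq_gaussianReal_s5 hV hVg.choose_spec
  have hW2 : MemLp W 2 P := memLp_two_of_map_eq_gaussianReal_s5 hW hWg.choose_spec
  have hZ2 : MemLp Z 2 P := memLp_two_of_map_eq_gaussianReal_s5 hZm hZg.choose_spec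
  have hVV : Integrable (fun ω => V ω ^ 2) P := hV2.integrable_sq
  have hWW : Integrable (fun ω => W ω ^ 2) P := hW2.integrable_sq
  have hVW : Integrable (fun ω => V ω * W ω) P := hV2.integrable_mul hW2
  have hcov : ∫ ω, V ω * Z ω ∂P = 0 := by
    have : ∀ ω, V ω * Z ω = V ω * W ω - b * V ω ^ 2 := fun ω => by simp only [hZ]; ring
    simp_rw [this]
    rw [integral_sub hVW (hVV.const_mul b), integral_const_mul, hc, hv]
    simp only [b]
    field_simp
    ring
  have hZvar : ∫ ω, Z ω ^ 2 ∂P = w - c ^ 2 / v := by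
    have : ∀ ω, Z ω ^ 2 = W ω ^ 2 - (2 * b) * (V ω * W ω) + b ^ 2 * V ω ^ 2 := fun ω => by
      simp only [hZ]; ring
    have hsub : Integrable (fun ω => W ω ^ 2 - (2 * b) * (V ω * W ω)) P :=
      hWW.sub (hVW.const_mul _)
    simp_rw [this]
    rw [integral_add hsub (hVV.const_mul _),
      integral_sub hWW (hVW.const_mul _), integral_const_mul, integral_const_mul, hc, hv, hw]
    simp only [b]
    field_simp
    ring
  have hind : IndepFun V Z P := by
    refine (hasGaussianLaw_prodMk_of_linearComb hV hZm hVZ).indepFun_of_covariance_eq_zero ?_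
    rw [covariance_eq_sub hV2 hZ2]
    have : P[V * Z] = 0 := hcov
    rw [this, integral_eq_zero_of_map_eq_gaussianReal hV hVg.choose_spec]
    simp
  have hVlaw := map_eq_gaussianReal_integral_sq hV hVg
  have hZlaw := map_eq_gaussianReal_integral_sq hZm hZg
  rw [hv] at hVlaw
  rw [hZvar] at hZlaw
  have hmap := (indepFun_iff_map_prod_eq_prod_map_map hV.aemeasurable hZm.aemeasurable).1 hind
  rw [hVlaw, hZlaw] at hmap
  set f : ℝ × ℝ → ℝ := (Prod.fst ⁻¹' B).indicator fun z => g (z.2 + b * z.1)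
  have hf : Measurable f :=
    (hg.comp (measurable_snd.add (measurable_fst.const_mul b))).indicator (measurable_fst hB)
  have hC : 0 ≤ C := (abs_nonneg _).trans (hgC 0)
  have hfC : ∀ z, ‖f z‖ ≤ C := fun z => by
    by_cases hz : z ∈ Prod.fst ⁻¹' B
    · simp only [f, indicator_of_mem hz]; exact hgC _
    · simp only [f, indicator_of_notMem hz, norm_zero, hC]
  have hσ' : (w - c ^ 2 / v).toNNReal ≠ 0 := (Real.toNNReal_pos.2 hσ).ne'
  have hv' : v.toNNReal ≠ 0 := (Real.toNNReal_pos.2 hv0).ne'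
  calc ∫ ω in V ⁻¹' B, g (W ω) ∂P
      = ∫ ω, f (V ω, Z ω) ∂P := by
        rw [← integral_indicator (hV hB)]
        refine integral_congr_ae (ae_of_all _ fun ω => ?_)
        by_cases hω : V ω ∈ B
        · simp only [f]
          rw [indicator_of_mem (by exact hω), indicator_of_mem (by exact hω)]
          simp [hZ]
        · simp only [f]
          rw [indicator_of_notMem (by exact hω), indicator_of_notMem (by exact hω)]
    _ = ∫ x, ∫ z, f (x, z) ∂(gaussianReal 0 (w - c ^ 2 / v).toNNReal)
          ∂(gaussianReal 0 v.toNNReal) := by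
        rw [← integral_map (f := f) (hV.prodMk hZm).aemeasurable hf.aestronglyMeasurable, hmap,
          integral_prod _ (Integrable.of_bound hf.aestronglyMeasurable C (ae_of_all _ hfC))]
    _ = ∫ x, B.indicator (fun x => ∫ y, g y *
          gaussianPDFReal (b * x) (w - c ^ 2 / v).toNNReal y) x ∂(gaussianReal 0 v.toNNReal) := by
        refine integral_congr_ae (ae_of_all _ fun x => ?_)
        by_cases hx : x ∈ B
        · have : ∀ z, f (x, z) = g (z + b * x) := fun z => indicator_of_mem (by exact hx) _
          simp only [this, indicator_of_mem hx]
          rw [← integral_map (f := g) (φ := fun z => z + b * x) (by fun_prop)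
            hg.aestronglyMeasurable, gaussianReal_map_add_const, zero_add,
            integral_gaussianReal_eq_integral_smul hσ']
          simp [mul_comm]
        · have : ∀ z, f (x, z) = 0 := fun z => indicator_of_notMem (by exact hx) _
          simp [this, hx]
    _ = _ := by
        rw [integral_indicator hB, gaussianReal_of_var_ne_zero _ hv',
          setIntegral_withDensity_eq_setIntegral_toReal_smul (measurable_gaussianPDF _ _)
            (ae_of_all _ fun x => gaussianPDF_lt_top) _ hB]
        simp [mul_comm]

theorem gaussianPDFReal_zero_le_inv_abs {v : ℝ} (hv : 0 < v) {x : ℝ} (hx : x ≠ 0) :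
    gaussianPDFReal 0 v.toNNReal x ≤ |x|⁻¹ := by
  rw [gaussianPDFReal, Real.coe_toNNReal _ hv.le, sub_zero]
  have hx' : 0 < |x| := abs_pos.2 hx
  have hs : 0 < √(2 * π * v) := by positivity
  rw [inv_mul_le_iff₀ hs, ← div_eq_mul_inv, le_div_iff₀ hx']
  refine Real.le_sqrt_of_sq_le ?_
  have hy : x ^ 2 / v * rexp (-(x ^ 2 / v)) ≤ 1 := by
    rw [Real.exp_neg, mul_inv_le_iff₀ (Real.exp_pos _), one_mul]
    linarith [Real.add_one_le_exp (x ^ 2 / v)]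
  have he : rexp (-x ^ 2 / (2 * v)) ^ 2 = rexp (-(x ^ 2 / v)) := by
    rw [← Real.exp_nat_mul]
    congr 1
    push_cast
    field_simp
  rw [mul_pow, sq_abs, he]
  have : rexp (-(x ^ 2 / v)) * x ^ 2 = v * (x ^ 2 / v * rexp (-(x ^ 2 / v))) := by
    field_simp
  rw [this]
  nlinarith [Real.pi_gt_three]

theorem abs_integral_mul_gaussianPDFReal_le {g : ℝ → ℝ} {C : ℝ} (hgC : ∀ x, |g x| ≤ C) (m : ℝ)
    (v : NNReal) : |∫ y, g y * gaussianPDFReal m v y| ≤ C := by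
  have hC : 0 ≤ C := (abs_nonneg _).trans (hgC 0)
  rcases eq_or_ne v 0 with rfl | hv
  · simpa using hC
  calc |∫ y, g y * gaussianPDFReal m v y| ≤ ∫ y, C * gaussianPDFReal m v y := by
        refine norm_integral_le_of_norm_le (f := fun y => g y * gaussianPDFReal m v y)
          ((integrable_gaussianPDFReal m v).const_mul C) (ae_of_all _ fun y => ?_)
        rw [norm_mul, Real.norm_of_nonneg (gaussianPDFReal_nonneg m v y)]
        exact mul_le_mul_of_nonneg_right (hgC y) (gaussianPDFReal_nonneg m v y)
    _ = C := by rw [integral_const_mul, integral_gaussianPDFReal_eq_one m hv, mul_one]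

theorem measurable_gaussianPDFReal_comp {α : Type*} [MeasurableSpace α] {m v x : α → ℝ}
    (hm : Measurable m) (hv : Measurable v) (hx : Measurable x) :
    Measurable fun a => gaussianPDFReal (m a) (v a).toNNReal (x a) := by
  simp only [gaussianPDFReal]
  fun_prop

theorem measurable_uncurry_max_s5 {Ω : Type*} [MeasurableSpace Ω] {X : ℝ → Ω → ℝ}
    (hX : ∀ t, 0 ≤ t → Measurable (X t)) (hc : ∀ ω, ContinuousOn (fun t => X t ω) (Ici 0))
    {s : ℝ} (hs : 0 ≤ s) : Measurable fun z : ℝ × Ω => X (max z.1 s) z.2 := by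
  refine measurable_uncurry_of_continuous_of_measurable (u := fun r ω => X (max r s) ω)
    (fun ω => ?_) fun r => hX _ (hs.trans (le_max_right r s))
  exact (hc ω).comp_continuous (by fun_prop) fun r => hs.trans (le_max_right r s)

theorem measurable_integral_mul_max {Ω : Type*} [MeasurableSpace Ω] {P : Measure Ω} [SFinite P]
    {X : ℝ → Ω → ℝ} (hX : ∀ t, 0 ≤ t → Measurable (X t))
    (hc : ∀ ω, ContinuousOn (fun t => X t ω) (Ici 0)) {s : ℝ} (hs : 0 ≤ s) {f : ℝ → Ω → ℝ}
    (hf : Measurable (Function.uncurry f)) :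
    Measurable fun r => ∫ ω, f r ω * X (max r s) ω ∂P :=
  (hf.mul (measurable_uncurry_max_s5 hX hc hs)).stronglyMeasurable.integral_prod_right.measurable

theorem integral_bridge_mul_bridge {Ω : Type*} [MeasurableSpace Ω] {P : Measure Ω}
    {X Y Z : Ω → ℝ} (hX : MemLp X 2 P) (hY : MemLp Y 2 P) (hZ : MemLp Z 2 P) :
    ∫ ω, (X ω - (∫ ω, X ω * Z ω ∂P) / (∫ ω, Z ω * Z ω ∂P) * Z ω) *
        (Y ω - (∫ ω, Y ω * Z ω ∂P) / (∫ ω, Z ω * Z ω ∂P) * Z ω) ∂P =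
      ∫ ω, X ω * Y ω ∂P -
        (∫ ω, X ω * Z ω ∂P) * (∫ ω, Y ω * Z ω ∂P) / ∫ ω, Z ω * Z ω ∂P := by
  set a := (∫ ω, X ω * Z ω ∂P) / (∫ ω, Z ω * Z ω ∂P) with ha
  set b := (∫ ω, Y ω * Z ω ∂P) / (∫ ω, Z ω * Z ω ∂P) with hb
  have hXY : Integrable (fun ω => X ω * Y ω) P := hX.integrable_mul hY
  have hXZ : Integrable (fun ω => X ω * Z ω) P := hX.integrable_mul hZ
  have hYZ : Integrable (fun ω => Y ω * Z ω) P := hY.integrable_mul hZ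
  have hZZ : Integrable (fun ω => Z ω * Z ω) P := hZ.integrable_mul hZ
  have : ∀ ω, (X ω - a * Z ω) * (Y ω - b * Z ω) =
      (X ω * Y ω - b * (X ω * Z ω)) - (a * (Y ω * Z ω) - a * b * (Z ω * Z ω)) := fun ω => by ring
  have h1 : Integrable (fun ω => X ω * Y ω - b * (X ω * Z ω)) P := hXY.sub (hXZ.const_mul b)
  have h2 : Integrable (fun ω => a * (Y ω * Z ω) - a * b * (Z ω * Z ω)) P :=
    (hYZ.const_mul a).sub (hZZ.const_mul _)
  simp_rw [this]
  rw [integral_sub h1 h2, integral_sub hXY (hXZ.const_mul b),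
    integral_sub (hYZ.const_mul a) (hZZ.const_mul _), integral_const_mul, integral_const_mul,
    integral_const_mul, ha, hb]
  field_simp
  ring

theorem measurable_bridge {Ω : Type*} [MeasurableSpace Ω] {X : ℝ → Ω → ℝ}
    (hX : ∀ t, 0 ≤ t → Measurable (X t))
    (hXc : ∀ ω, ContinuousOn (fun t => X t ω) (Ici 0)) {s : ℝ} (hs : 0 ≤ s) {a : ℝ → ℝ}
    (ha : Measurable a) {V : ℝ → Ω → ℝ}
    (hV : ∀ r ω, V r ω = X s ω - a r * X (max r s) ω) :
    Measurable fun z : ℝ × Ω => V z.1 z.2 := by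
  simp_rw [hV]
  exact ((hX s hs).comp measurable_snd).sub
    ((ha.comp measurable_fst).mul (measurable_uncurry_max_s5 hX hXc hs))

/-- The σ-algebra generated by the process `X` on `[0, ∞)`. -/
abbrev pathSigmaAlgebra {Ω : Type*} (X : ℝ → Ω → ℝ) : MeasurableSpace Ω :=
  ⨆ t ∈ Ici (0 : ℝ), MeasurableSpace.comap (X t) inferInstance

theorem pathSigmaAlgebra_le {Ω : Type*} [m : MeasurableSpace Ω] {X : ℝ → Ω → ℝ}
    (hX : ∀ t, Measurable (X t)) : pathSigmaAlgebra X ≤ m :=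
  iSup₂_le fun t _ => (hX t).comap_le

theorem measurable_pathSigmaAlgebra {Ω : Type*} (X : ℝ → Ω → ℝ) {t : ℝ} (ht : 0 ≤ t) :
    Measurable[pathSigmaAlgebra X] (X t) :=
  Measurable.mono (comap_measurable (X t))
    (le_iSup₂_of_le (f := fun t (_ : t ∈ Ici (0 : ℝ)) =>
      MeasurableSpace.comap (X t) inferInstance) t ht le_rfl) le_rfl

/-- One–dimensional transition formula: for 0 < t < u with F(t) > 0 and g bounded
measurable, E[g(ξ_u) | σ(ξ_t)] is given by the explicit Bayes formula. -/
theorem stmt_5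
    {Ω : Type*} [MeasurableSpace Ω] (P : Measure Ω) [IsProbabilityMeasure P]
    (X : ℝ → Ω → ℝ)
    (hXmeas : ∀ t, Measurable (X t))
    (hGauss : ∀ (m : ℕ) (ts : Fin m → ℝ), (∀ i, 0 ≤ ts i) → ∀ c : Fin m → ℝ,
      ∃ v : NNReal, Measure.map (fun ω => ∑ i, c i * X (ts i) ω) P = gaussianReal 0 v)
    (hXcont : ∀ ω, ContinuousOn (fun t => X t ω) (Set.Ici 0))
    (hX0 : ∀ᵐ ω ∂P, X 0 ω = 0)
    (R : ℝ → ℝ → ℝ)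
    (hR : ∀ s t, R s t = ∫ ω, X s ω * X t ω ∂P)
    (hRpos : ∀ t, 0 < t → 0 < R t t)
    (hRnd : ∀ s t, 0 < s → 0 < t → s ≠ t → (R s t)^2 < R s s * R t t)
    (ξr : ℝ → ℝ → Ω → ℝ)
    (hξr : ∀ r t ω, ξr r t ω = X t ω - R t (max r t) / R (max r t) (max r t) * X (max r t) ω)
    (τ : Ω → ℝ) (hτmeas : Measurable τ) (hτpos : ∀ ω, 0 < τ ω)
    (hindep : Indep (MeasurableSpace.comap τ inferInstance)
      (⨆ t ∈ Set.Ici (0:ℝ), MeasurableSpace.comap (X t) inferInstance) P)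
    (F : ℝ → ℝ) (hF : ∀ t, F t = (P {ω | τ ω ≤ t}).toReal)
    (ξ : ℝ → Ω → ℝ) (hξ : ∀ t ω, ξ t ω = ξr (τ ω) t ω)
    (p : ℝ → ℝ → ℝ → ℝ)
    (hp : ∀ v x y, 0 < v →
      p v x y = (Real.sqrt (2 * Real.pi * v))⁻¹ * Real.exp (-(x - y)^2 / (2*v)))
    (A : ℝ → ℝ → ℝ) (hA : ∀ t s, A t s = R s s * R t t - R s t ^ 2)
    (φ : ℝ → ℝ → ℝ → ℝ) (hφ : ∀ t r x, 0 < t → t < r → φ t r x = p (A t r / R r r) x 0)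
    (ϕ : ℝ → ℝ → ℝ → ℝ)
    (hϕ : ∀ t r x, 0 < t → t < r →
      ϕ t r x = φ t r x / ∫ s in Set.Ioi t, φ t s x ∂(Measure.map τ P))
    (μB σB : ℝ → ℝ → ℝ → ℝ)
    (hμB : ∀ t u r, 0 < t → 0 < u → t < r → u < r →
      μB t u r = (R u t * R r r - R u r * R t r) / A t r)
    (hσB : ∀ t u r, 0 < t → 0 < u → t < r → u < r →
      σB t u r = A u r / R r r - (R u t * R r r - R u r * R t r)^2 / (R r r * A t r))
    (hnondeg : ∀ t u r, 0 < t → 0 < u → t < r → u < r → t ≠ u → 0 < σB t u r)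
    (t u : ℝ) (ht : 0 < t) (htu : t < u) (hFt : 0 < F t)
    (g : ℝ → ℝ) (hgmeas : Measurable g) (C : ℝ) (hgbdd : ∀ x, |g x| ≤ C) :
    P[(fun ω => g (ξ u ω))|MeasurableSpace.comap (ξ t) inferInstance] =ᵐ[P]
      fun ω => g 0 * ((if ξ t ω = 0 then 1 else 0)
          + (∫ r in Set.Ioc t u, ϕ t r (ξ t ω) ∂(Measure.map τ P)) *
            (if ξ t ω ≠ 0 then 1 else 0))
        + (∫ r in Set.Ioi u,
            (∫ y, g y * p (σB t u r) y (μB t u r * ξ t ω)) * ϕ t r (ξ t ω)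
              ∂(Measure.map τ P)) *
          (if ξ t ω ≠ 0 then 1 else 0) := by
  have hXm : ∀ t, 0 ≤ t → Measurable (X t) := fun t _ => hXmeas t
  have hu : 0 < u := ht.trans htu
  have hsymm : ∀ a b, R a b = R b a := fun a b => by
    rw [hR, hR]; exact integral_congr_ae (ae_of_all _ fun ω => mul_comm _ _)
  have hp' : ∀ v x y, 0 < v → p v x y = gaussianPDFReal y v.toNNReal x := fun v x y hv => by
    rw [hp v x y hv, gaussianPDFReal, Real.coe_toNNReal _ hv.le]
  have hLp : ∀ a, 0 ≤ a → MemLp (X a) 2 P := fun a ha => by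
    obtain ⟨v, hv⟩ := hGauss 1 (fun _ => a) (fun _ => ha) fun _ => 1
    exact memLp_two_of_map_eq_gaussianReal_s5 (hXmeas a) (by simpa using hv)
  -- The covariances of the bridge, as measurable functions of its length.
  have hRm : ∀ a s, 0 ≤ s → Measurable fun r => R a (max r s) := fun a s hs => by
    simp_rw [hR]
    exact measurable_integral_mul_max hXm hXcont hs (f := fun _ => X a)
      ((hXmeas a).comp measurable_snd)
  have hRm' : ∀ s, 0 ≤ s → Measurable fun r => R (max r s) (max r s) := fun s hs => by
    simp_rw [hR]
    exact measurable_integral_mul_max hXm hXcont hs (f := fun r => X (max r s))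
      (measurable_uncurry_max_s5 hXm hXcont hs)
  set v : ℝ → ℝ := fun r => R t t - R t (max r t) * R t (max r t) / R (max r t) (max r t)
  set c : ℝ → ℝ := fun r => R t u - R t (max r t) * R u (max r t) / R (max r t) (max r t)
  set w : ℝ → ℝ := fun r => R u u - R u (max r t) * R u (max r t) / R (max r t) (max r t)
  have hvm : Measurable v :=
    (((hRm t t ht.le).mul (hRm t t ht.le)).div (hRm' t ht.le)).const_sub _
  have hcm : Measurable c :=
    (((hRm t t ht.le).mul (hRm u t ht.le)).div (hRm' t ht.le)).const_sub _
  have hwm : Measurable w :=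
    (((hRm u t ht.le).mul (hRm u t ht.le)).div (hRm' t ht.le)).const_sub _
  have hRr0 : ∀ r, t < r → 0 < R r r := fun r hr => hRpos r (ht.trans hr)
  have hA0 : ∀ r, t < r → 0 < A t r := fun r hr => by
    have := hRnd r t (ht.trans hr) ht hr.ne'
    rw [hA]; linarith
  have hvA : ∀ r, t < r → A t r / R r r = v r := fun r hr => by
    have := (hRr0 r hr).ne'
    simp only [v, max_eq_left hr.le]
    rw [hA, hsymm r t]
    field_simp
  have hv0 : ∀ r, t < r → 0 < v r := fun r hr => hvA r hr ▸ div_pos (hA0 r hr) (hRr0 r hr)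
  have hμ : ∀ r, u < r → μB t u r = c r / v r := fun r hr => by
    have htr := htu.trans hr
    have h1 := (hRr0 r htr).ne'
    have h2 := (hA0 r htr).ne'
    rw [hμB t u r ht hu htr hr, ← hvA r htr]
    simp only [c, max_eq_left htr.le]
    rw [hsymm t u]
    field_simp
  have hσ : ∀ r, u < r → σB t u r = w r - c r ^ 2 / v r := fun r hr => by
    have htr := htu.trans hr
    have h1 := (hRr0 r htr).ne'
    have h2 := (hA0 r htr).ne'
    rw [hσB t u r ht hu htr hr, ← hvA r htr, hA u r]
    simp only [c, w, max_eq_left htr.le]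
    rw [hsymm t u, hsymm r u]
    field_simp
  have hσ0 : ∀ r, u < r → 0 < w r - c r ^ 2 / v r := fun r hr =>
    hσ r hr ▸ hnondeg t u r ht hu (htu.trans hr) hr htu.ne
  set f : ℝ → ℝ → ℝ := fun r x => gaussianPDFReal 0 (v r).toNNReal x
  set K : ℝ → ℝ → ℝ := fun r x => if r ≤ u then g 0 else
    ∫ y, g y * gaussianPDFReal (c r / v r * x) (w r - c r ^ 2 / v r).toNNReal y
  have hfm : Measurable (Function.uncurry f) :=
    measurable_gaussianPDFReal_comp measurable_const (hvm.comp measurable_fst) measurable_snd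
  have hKm : Measurable (Function.uncurry K) := by
    refine Measurable.ite (measurable_fst measurableSet_Iic) measurable_const ?_
    refine StronglyMeasurable.measurable (StronglyMeasurable.integral_prod_right
      (f := fun (z : ℝ × ℝ) y => g y * gaussianPDFReal (c z.1 / v z.1 * z.2)
        (w z.1 - c z.1 ^ 2 / v z.1).toNNReal y) ?_)
    refine Measurable.stronglyMeasurable ((hgmeas.comp measurable_snd).mul
      (measurable_gaussianPDFReal_comp ?_ ?_ measurable_snd))
    · fun_prop
    · fun_prop
  have hKC : ∀ r x, |K r x| ≤ C := fun r x => by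
    by_cases hr : r ≤ u
    · simp only [K, hr, if_true]; exact hgbdd 0
    · simp only [K, hr, if_false]; exact abs_integral_mul_gaussianPDFReal_le hgbdd _ _
  have hbridge : ∀ s, 0 ≤ s → Measurable[@Prod.instMeasurableSpace _ _ _ (pathSigmaAlgebra X)]
      fun z : ℝ × Ω => ξr z.1 s z.2 := fun s hs =>
    @measurable_bridge Ω (pathSigmaAlgebra X) X (fun _ => measurable_pathSigmaAlgebra X) hXcont s
      hs _ ((hRm s s hs).div (hRm' s hs)) _ fun r => hξr r s
  have hind : @IndepFun Ω ℝ Ω _ _ (pathSigmaAlgebra X) τ id P := by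
    refine (@IndepFun_iff_Indep Ω ℝ Ω _ _ (pathSigmaAlgebra X) τ id P).2 ?_
    rw [MeasurableSpace.comap_id]
    exact hindep
  have hξrm : ∀ r s, Measurable (ξr r s) := fun r s => by
    have : ξr r s = fun ω => X s ω - R s (max r s) / R (max r s) (max r s) * X (max r s) ω :=
      funext (hξr r s)
    rw [this]
    exact (hXmeas s).sub ((hXmeas _).const_mul _)
  have hξrzero : ∀ r s, 0 < s → r ≤ s → ∀ ω, ξr r s ω = 0 := fun r s hs hrs ω => by
    rw [hξr, max_eq_right hrs, div_self (hRpos s hs).ne', one_mul, sub_self]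
  have hξrmul : ∀ r a b, 0 < a → a < r → 0 < b → b < r → ∫ ω, ξr r a ω * ξr r b ω ∂P =
      R a b - R a r * R b r / R r r := fun r a b ha har hb hbr => by
    have hr : 0 < r := ha.trans har
    simp_rw [hξr, max_eq_left har.le, max_eq_left hbr.le, hR]
    exact integral_bridge_mul_bridge (hLp a ha.le) (hLp b hb.le) (hLp r hr.le)
  have hjoint : ∀ r, t < r → ∀ a b : ℝ, u < r ∨ b = 0 → ∃ s : NNReal,
      P.map (fun ω => a * ξr r t ω + b * ξr r u ω) = gaussianReal 0 s := by
    intro r htr a b hb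
    obtain ⟨s, hs⟩ := hGauss 3 ![t, u, r]
      (by intro i; fin_cases i <;> simp [ht.le, hu.le, (ht.trans htr).le])
      ![a, b, -(a * (R t r / R r r) + b * (R u r / R r r))]
    refine ⟨s, hs ▸ ?_⟩
    congr 1
    ext ω
    simp only [Fin.sum_univ_three, hξr, max_eq_left htr.le]
    rcases hb with hur | rfl
    · rw [max_eq_left hur.le]
      simp
      ring
    · simp
      ring
  have hvar : ∀ r, t < r → ∫ ω, ξr r t ω ^ 2 ∂P = v r := fun r htr => by
    simp_rw [sq, hξrmul r t t ht htr ht htr, v, max_eq_left htr.le]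
  have hlaw : ∀ r, t < r → P.map (ξr r t) = gaussianReal 0 (v r).toNNReal := fun r htr => by
    rw [← hvar r htr]
    exact map_eq_gaussianReal_integral_sq (hξrm r t) (by simpa using hjoint r htr 1 0 (.inr rfl))
  have hlaw' : ∀ r, t < r →
      P.map (ξr r t) = volume.withDensity fun x => ENNReal.ofReal (f r x) := fun r htr => by
    rw [hlaw r htr, gaussianReal_of_var_ne_zero _ (Real.toNNReal_pos.2 (hv0 r htr)).ne']
    rfl
  have hcond : ∀ r, t < r → ∀ B, MeasurableSet B →
      ∫ ω in ξr r t ⁻¹' B, g (ξr r u ω) ∂P = ∫ x in B, K r x * f r x := by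
    intro r htr B hB
    rcases le_or_gt r u with hru | hur
    · simp only [hξrzero r u hu hru, K, hru, if_true]
      have hreal : ∫ x in B, f r x = P.real (ξr r t ⁻¹' B) := by
        rw [measureReal_def, ← Measure.map_apply (hξrm r t) hB, hlaw' r htr,
          withDensity_apply _ hB, integral_eq_lintegral_of_nonneg_ae
            (ae_of_all _ fun x => gaussianPDFReal_nonneg _ _ x)
            (measurable_gaussianPDFReal _ _).aestronglyMeasurable]
      rw [integral_const_mul, hreal]
      simp [mul_comm]
    · simp only [K, not_le.2 hur, if_false]
      refine setIntegral_comp_of_jointly_gaussian (hξrm r t) (hξrm r u)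
        (fun a b => hjoint r htr a b (.inl hur)) (hvar r htr) ?_ ?_ (hv0 r htr) (hσ0 r hur)
        hgmeas hgbdd hB
      · simp only [hξrmul r t u ht htr hu hur, c, max_eq_left htr.le]
      · simp_rw [sq, hξrmul r u u hu hur hu hur, w, max_eq_left htr.le]
  have key := @condExp_eq_of_mixture Ω Ω _ (pathSigmaAlgebra X) P _ τ id hτmeas
    (measurable_id'' (pathSigmaAlgebra_le hXmeas)) hind
    (fun z => ξr z.1 t z.2) (fun z => ξr z.1 u z.2) (hbridge t ht.le) (hbridge u hu.le) g hgmeas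
    C hgbdd t f K hfm hKm (fun r x => gaussianPDFReal_nonneg _ _ x) hKC
    (fun r hr ω => ⟨hξrzero r t ht hr ω, hξrzero r u hu (hr.trans htu.le) ω⟩) hlaw' hcond
  have hξ' : ∀ s, ξ s = fun ω => ξr (τ ω) s ω := fun s => funext (hξ s)
  rw [hξ' t, hξ' u]
  refine key.trans (ae_of_all _ fun ω => ?_)
  simp only [id]
  by_cases hx : ξr (τ ω) t ω = 0
  · simp [hx]
  rw [if_neg hx, if_neg hx, if_pos hx, zero_add, mul_one, mul_one]
  generalize ξr (τ ω) t ω = x at hx ⊢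
  have : IsProbabilityMeasure (P.map τ) := Measure.isProbabilityMeasure_map hτmeas.aemeasurable
  have hφf : ∀ r, t < r → φ t r x = f r x := fun r hr => by
    rw [hφ t r x ht hr, hvA r hr, hp' _ _ _ (hv0 r hr)]
  have hD : ∫ s in Ioi t, φ t s x ∂(P.map τ) = ∫ s in Ioi t, f s x ∂(P.map τ) :=
    setIntegral_congr_fun measurableSet_Ioi hφf
  set D := ∫ s in Ioi t, f s x ∂(P.map τ)
  have hϕf : ∀ r, t < r → ϕ t r x = f r x / D := fun r hr => by
    rw [hϕ t r x ht hr, hφf r hr, hD]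
  have hKint : IntegrableOn (fun r => K r x * f r x) (Ioi t) (P.map τ) := by
    refine IntegrableOn.of_bound (measure_lt_top _ _)
      ((hKm.comp (measurable_id.prodMk measurable_const)).mul
        (hfm.comp (measurable_id.prodMk measurable_const))).aestronglyMeasurable (C * |x|⁻¹) ?_
    refine ae_restrict_of_forall_mem measurableSet_Ioi fun r hr => ?_
    rw [norm_mul, Real.norm_of_nonneg (gaussianPDFReal_nonneg _ _ x)]
    exact mul_le_mul (hKC r x) (gaussianPDFReal_zero_le_inv_abs (hv0 r hr) hx)
      (gaussianPDFReal_nonneg _ _ x) ((abs_nonneg _).trans (hgbdd 0))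
  have hsplit : ∫ r in Ioi t, K r x * f r x ∂(P.map τ) =
      ∫ r in Ioc t u, K r x * f r x ∂(P.map τ) + ∫ r in Ioi u, K r x * f r x ∂(P.map τ) := by
    rw [← Ioc_union_Ioi_eq_Ioi htu.le] at hKint ⊢
    exact setIntegral_union (Ioc_disjoint_Ioi le_rfl) measurableSet_Ioi hKint.left_of_union
      hKint.right_of_union
  have hIoc : ∫ r in Ioc t u, K r x * f r x ∂(P.map τ) =
      g 0 * ∫ r in Ioc t u, f r x ∂(P.map τ) := by
    rw [← integral_const_mul]
    exact setIntegral_congr_fun measurableSet_Ioc fun r hr => by simp only [K, hr.2, if_true]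
  have hIoc' : ∫ r in Ioc t u, ϕ t r x ∂(P.map τ) = (∫ r in Ioc t u, f r x ∂(P.map τ)) / D := by
    rw [← integral_div]
    exact setIntegral_congr_fun measurableSet_Ioc fun r hr => hϕf r hr.1
  have hIoi : ∫ r in Ioi u, (∫ y, g y * p (σB t u r) y (μB t u r * x)) * ϕ t r x ∂(P.map τ) =
      (∫ r in Ioi u, K r x * f r x ∂(P.map τ)) / D := by
    rw [← integral_div]
    refine setIntegral_congr_fun measurableSet_Ioi fun r hr => ?_
    have hr : u < r := hr
    simp only [K, not_le.2 hr, if_false]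
    rw [hϕf r (htu.trans hr), hσ r hr, hμ r hr]
    simp_rw [hp' _ _ _ (hσ0 r hr)]
    ring
  rw [hIoc', hIoi, hsplit, hIoc]
  ring
end

section
/- For every r > 0, the Gaussian bridge ξ^r of length r is a Markov process with respect to its completed natural filtration: for all 0 ≤ t < u and every bounded measurable g : ℝ → ℝ, E[g(ξ^r_u) | σ(ξ^r_s : s ≤ t) ∨ 𝓝_ℙ] = E[g(ξ^r_u) | σ(ξ^r_t)] ℙ-a.s. -/
open MeasureTheory ProbabilityTheory Real Set

/-- A process all of whose finite linear combinations are real Gaussian variables is a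
Gaussian process. -/
lemma isGaussianProcess_of_forall_sum {Ω T : Type*} {mΩ : MeasurableSpace Ω} {P : Measure Ω}
    {X : T → Ω → ℝ} (hX : ∀ t, Measurable (X t))
    (h : ∀ (m : ℕ) (ts : Fin m → T) (c : Fin m → ℝ),
      ∃ μ v, P.map (fun ω => ∑ i, c i * X (ts i) ω) = gaussianReal μ v) :
    IsGaussianProcess X P where
  hasGaussianLaw I := by
    classical
    refine ⟨isGaussian_of_map_eq_gaussianReal fun L => ?_⟩
    obtain ⟨μ, v, hv⟩ := h I.card (fun i => (I.equivFin.symm i : T))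
      (fun i => L (Pi.single (I.equivFin.symm i) 1))
    refine ⟨μ, v, ?_⟩
    rw [Measure.map_map (by fun_prop) (by fun_prop), ← hv]
    congr 1
    ext ω
    rw [Function.comp_apply, ← L.sum_comp_single, ← I.equivFin.symm.sum_comp]
    refine Finset.sum_congr rfl fun i _ => ?_
    have hsingle : Pi.single (I.equivFin.symm i) (X (I.equivFin.symm i) ω)
        = X (I.equivFin.symm i) ω • (Pi.single (I.equivFin.symm i) 1 : I → ℝ) := by
      rw [← Pi.single_smul, smul_eq_mul, mul_one]
    simp only [ContinuousLinearMap.comp_apply, ContinuousLinearMap.single_apply,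
      Finset.restrict_def]
    rw [hsingle, map_smul, smul_eq_mul, mul_comm]

/-- The freezing lemma: if `W` is `m`-measurable and `Z` is independent of `m`, then the conditional
expectation of `f (W, Z)` given `m` is obtained by integrating out `Z`. -/
lemma condExp_comp_prodMk_of_indep {Ω : Type*} {m mΩ : MeasurableSpace Ω} {P : Measure Ω}
    [IsProbabilityMeasure P] (hm : m ≤ mΩ) {W Z : Ω → ℝ} (hW : Measurable[m] W)
    (hZ : Measurable Z) (hind : Indep m (MeasurableSpace.comap Z inferInstance) P)
    {f : ℝ × ℝ → ℝ} (hf : Measurable f) {C : ℝ} (hC : ∀ x, |f x| ≤ C) :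
    P[fun ω => f (W ω, Z ω)|m] =ᵐ[P] fun ω => ∫ z, f (W ω, z) ∂(P.map Z) := by
  have hW' : Measurable W := hW.mono hm le_rfl
  have : IsProbabilityMeasure (P.map Z) := Measure.isProbabilityMeasure_map hZ.aemeasurable
  have hφ : StronglyMeasurable fun w => ∫ z, f (w, z) ∂(P.map Z) :=
    StronglyMeasurable.integral_prod_right (f := fun w z => f (w, z)) hf.stronglyMeasurable
  have hφC (w : ℝ) : ‖∫ z, f (w, z) ∂(P.map Z)‖ ≤ C :=
    (norm_integral_le_of_norm_le_const (ae_of_all _ fun z => hC (w, z))).trans (by simp)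
  refine (ae_eq_condExp_of_forall_setIntegral_eq hm ?_ ?_ ?_ ?_).symm
  · exact .of_bound (hf.comp (hW'.prodMk hZ)).aestronglyMeasurable C (ae_of_all _ fun ω => hC _)
  · exact fun s _ _ => (Integrable.of_bound
      (hφ.comp_measurable hW').aestronglyMeasurable C (ae_of_all _ fun ω => hφC _)).integrableOn
  · intro A hA _
    let V : Ω → ℝ × ℝ := fun ω => (A.indicator (fun _ => 1) ω, W ω)
    have hVm : Measurable[m] V := (measurable_const.indicator hA).prodMk hW
    have hV : Measurable V := hVm.mono hm le_rfl
    have hVZ : IndepFun V Z P := indep_of_indep_of_le_left hind hVm.comap_le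
    have hlaw := hVZ.map_prod_eq_prod_map_map hV.aemeasurable hZ.aemeasurable
    let F : (ℝ × ℝ) × ℝ → ℝ := fun p => p.1.1 * f (p.1.2, p.2)
    have hF : Measurable F := by fun_prop
    have hFint : Integrable F ((P.map V).prod (P.map Z)) := by
      rw [← hlaw, integrable_map_measure hF.aestronglyMeasurable (by fun_prop)]
      refine .of_bound (hF.comp (hV.prodMk hZ)).aestronglyMeasurable C (ae_of_all _ fun ω => ?_)
      have h0 : 0 ≤ C := (abs_nonneg _).trans (hC (0, 0))
      by_cases hω : ω ∈ A <;> simp [F, V, hω, hC, h0]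
    calc ∫ ω in A, (∫ z, f (W ω, z) ∂(P.map Z)) ∂P
        = ∫ ω, (V ω).1 * ∫ z, f ((V ω).2, z) ∂(P.map Z) ∂P := by
          rw [← integral_indicator (hm _ hA)]
          congr 1 with ω
          by_cases hω : ω ∈ A <;> simp [V, hω]
      _ = ∫ v, ∫ z, F (v, z) ∂(P.map Z) ∂(P.map V) := by
          rw [integral_map hV.aemeasurable
            hF.stronglyMeasurable.integral_prod_right.aestronglyMeasurable]
          simp only [F, integral_const_mul]
      _ = ∫ ω, F (V ω, Z ω) ∂P := by
          rw [← integral_prod _ hFint, ← hlaw, integral_map (by fun_prop) hF.aestronglyMeasurable]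
      _ = ∫ ω in A, f (W ω, Z ω) ∂P := by
          rw [← integral_indicator (hm _ hA)]
          congr 1 with ω
          by_cases hω : ω ∈ A <;> simp [F, V, hω]
  · exact (hφ.measurable.comp hW).stronglyMeasurable.aestronglyMeasurable

/-- Completing a σ-algebra with the null sets preserves independence. -/
lemma Indep.sup_generateFrom_null {Ω : Type*} {m₁ m₂ mΩ : MeasurableSpace Ω} {P : Measure Ω}
    (h : Indep m₁ m₂ P) :
    Indep (m₁ ⊔ MeasurableSpace.generateFrom {s : Set Ω | P s = 0}) m₂ P := by
  have hle : m₁ ⊔ MeasurableSpace.generateFrom {s : Set Ω | P s = 0}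
      ≤ eventuallyMeasurableSpace m₁ (ae P) := by
    refine sup_le le_eventuallyMeasurableSpace (MeasurableSpace.generateFrom_le fun s hs => ?_)
    exact ⟨∅, @MeasurableSet.empty _ m₁, ae_eq_empty.2 hs⟩
  rw [Indep_iff] at h ⊢
  intro A B hA hB
  obtain ⟨A', hA', hAA'⟩ := hle A hA
  rw [measure_congr (hAA'.inter (ae_eq_refl B)), measure_congr hAA', h A' B hA' hB]

/-- A Gaussian process is Markov, with respect to its completed natural filtration, as soon as
some residual `Y u - a * Y t` is uncorrelated with the past of `Y` up to time `t`. -/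
lemma IsGaussianProcess.condExp_past_eq_of_covariance_eq_zero {Ω T : Type*}
    {mΩ : MeasurableSpace Ω} {P : Measure Ω} [IsProbabilityMeasure P] {Y : T → Ω → ℝ}
    (hY : ∀ s, Measurable (Y s)) {S : Set T} (hG : IsGaussianProcess Y P) {t u : T} (htS : t ∈ S)
    {a : ℝ} (hcov : ∀ s ∈ S, cov[Y s, fun ω => Y u ω - a * Y t ω; P] = 0)
    (hcomplete : ∀ s : Set Ω, P s = 0 → MeasurableSet s)
    {g : ℝ → ℝ} (hg : Measurable g) {C : ℝ} (hC : ∀ x, |g x| ≤ C) :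
    P[fun ω => g (Y u ω)|(⨆ s ∈ S, MeasurableSpace.comap (Y s) inferInstance) ⊔
      MeasurableSpace.generateFrom {s : Set Ω | P s = 0}] =ᵐ[P]
    P[fun ω => g (Y u ω)|MeasurableSpace.comap (Y t) inferInstance] := by
  classical
  let Z : Ω → ℝ := fun ω => Y u ω - a * Y t ω
  have hZ : Measurable Z := by fun_prop
  have hjoint : IsGaussianProcess
      (Sum.elim (fun s : S => Y s) (fun _ : Unit => Z)) P := by
    refine hG.of_isGaussianProcess fun i => ?_
    rcases i with s | _
    · exact ⟨{s.1}, .proj ⟨s.1, by simp⟩, fun ω => rfl⟩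
    · exact ⟨{u, t}, .proj ⟨u, by simp⟩ - a • .proj ⟨t, by simp⟩, fun ω => rfl⟩
  have hind : IndepFun (fun ω (s : S) => Y s ω) (fun ω (_ : Unit) => Z ω) P :=
    hjoint.indepFun_of_covariance_eq_zero (fun s => (hY s).aemeasurable)
      (fun _ => hZ.aemeasurable) fun s _ => hcov s s.2
  have hpast : (⨆ s ∈ S, MeasurableSpace.comap (Y s) inferInstance) ≤
      MeasurableSpace.comap (fun ω (s : S) => Y s ω) inferInstance := by
    refine iSup₂_le fun s hs => ?_
    rw [show Y s = (fun x : S → ℝ => x ⟨s, hs⟩) ∘ (fun ω (s : S) => Y s ω) from rfl,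
      ← MeasurableSpace.comap_comp]
    exact MeasurableSpace.comap_mono (measurable_pi_apply _).comap_le
  have hind' : Indep ((⨆ s ∈ S, MeasurableSpace.comap (Y s) inferInstance) ⊔
      MeasurableSpace.generateFrom {s : Set Ω | P s = 0})
      (MeasurableSpace.comap Z inferInstance) P :=
    Indep.sup_generateFrom_null (indep_of_indep_of_le_left
      (hind.comp measurable_id (measurable_pi_apply ())) hpast)
  have hle : MeasurableSpace.comap (Y t) inferInstance ≤
      (⨆ s ∈ S, MeasurableSpace.comap (Y s) inferInstance) ⊔
      MeasurableSpace.generateFrom {s : Set Ω | P s = 0} :=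
    le_sup_of_le_left (le_iSup₂_of_le t htS le_rfl)
  have hm : (⨆ s ∈ S, MeasurableSpace.comap (Y s) inferInstance) ⊔
      MeasurableSpace.generateFrom {s : Set Ω | P s = 0} ≤ mΩ :=
    sup_le (iSup₂_le fun s _ => (hY s).comap_le) (MeasurableSpace.generateFrom_le hcomplete)
  have hrw : (fun ω => g (Y u ω)) =
      fun ω => (fun p : ℝ × ℝ => g (a * p.1 + p.2)) (Y t ω, Z ω) := by
    ext ω
    simp [Z]
  have hmeas : Measurable fun p : ℝ × ℝ => g (a * p.1 + p.2) := by fun_prop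
  rw [hrw]
  exact (condExp_comp_prodMk_of_indep hm ((comap_measurable _).mono hle le_rfl) hZ hind'
      hmeas fun _ => hC _).trans
    (condExp_comp_prodMk_of_indep (hY t).comap_le (comap_measurable _) hZ
      (indep_of_indep_of_le_left hind' hle) hmeas fun _ => hC _).symm

/-- The deterministic-length bridge ξ^r is Markov w.r.t. its completed natural
filtration: E[g(ξ^r_u) | σ(ξ^r_s : s ≤ t) ∨ 𝓝_ℙ] = E[g(ξ^r_u) | σ(ξ^r_t)] a.s. -/
theorem stmt_8
    {Ω : Type*} [MeasurableSpace Ω] (P : Measure Ω) [IsProbabilityMeasure P]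
    (X : ℝ → Ω → ℝ)
    (hXmeas : ∀ t, Measurable (X t))
    (hGauss : ∀ (m : ℕ) (ts : Fin m → ℝ), (∀ i, 0 ≤ ts i) → ∀ c : Fin m → ℝ,
      ∃ v : NNReal, Measure.map (fun ω => ∑ i, c i * X (ts i) ω) P = gaussianReal 0 v)
    (hXcont : ∀ ω, ContinuousOn (fun t => X t ω) (Set.Ici 0))
    (hX0 : ∀ᵐ ω ∂P, X 0 ω = 0)
    (R : ℝ → ℝ → ℝ)
    (hR : ∀ s t, R s t = ∫ ω, X s ω * X t ω ∂P)
    (hRpos : ∀ t, 0 < t → 0 < R t t)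
    (hRnd : ∀ s t, 0 < s → 0 < t → s ≠ t → (R s t)^2 < R s s * R t t)
    (ξr : ℝ → ℝ → Ω → ℝ)
    (hξr : ∀ r t ω, ξr r t ω = X t ω - R t (max r t) / R (max r t) (max r t) * X (max r t) ω)
    (ρ q : ℝ → ℝ)
    (hfact : ∀ s t, 0 ≤ s → 0 ≤ t → R s t = ρ (min s t) * q (max s t))
    (hρcont : ContinuousOn ρ (Set.Ici 0)) (hqcont : ContinuousOn q (Set.Ici 0))
    (hρ0 : ρ 0 = 0)
    (hρpos : ∀ t, 0 < t → 0 < ρ t) (hqpos : ∀ t, 0 < t → 0 < q t)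
    (hρq : MonotoneOn (fun t => ρ t / q t) (Set.Ioi 0))
    (hcomplete : ∀ s : Set Ω, P s = 0 → MeasurableSet s)
    (r : ℝ) (hr : 0 < r) (t u : ℝ) (ht : 0 ≤ t) (htu : t < u)
    (g : ℝ → ℝ) (hgmeas : Measurable g) (C : ℝ) (hgbdd : ∀ x, |g x| ≤ C) :
    P[(fun ω => g (ξr r u ω))|(⨆ s ∈ Set.Icc (0:ℝ) t,
        MeasurableSpace.comap (ξr r s) inferInstance) ⊔
      MeasurableSpace.generateFrom {s : Set Ω | P s = 0}] =ᵐ[P]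
    P[(fun ω => g (ξr r u ω))|MeasurableSpace.comap (ξr r t) inferInstance] := by
  have hξmeas (s : ℝ) : Measurable (ξr r s) := by
    rw [show ξr r s = fun ω => X s ω - R s (max r s) / R (max r s) (max r s) * X (max r s) ω
      from funext (hξr r s)]
    fun_prop
  rcases le_or_gt r u with hru | hur
  · have hzero : (fun ω => g (ξr r u ω)) = fun _ => g 0 := by
      ext ω
      rw [hξr, max_eq_right hru, div_self (hRpos u (hr.trans_le hru)).ne', one_mul, sub_self]
    rw [hzero, condExp_const, condExp_const]
    · exact (hξmeas t).comap_le
    · exact sup_le (iSup₂_le fun s _ => (hξmeas s).comap_le)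
        (MeasurableSpace.generateFrom_le hcomplete)
  have hXG : IsGaussianProcess (fun s : Ici (0 : ℝ) => X s) P :=
    isGaussianProcess_of_forall_sum (fun s => hXmeas s) fun m ts c =>
      ⟨0, hGauss m (fun i => ts i) (fun i => (ts i).2) c⟩
  have hξG : IsGaussianProcess (fun s : Ici (0 : ℝ) => ξr r s) P := by
    classical
    refine hXG.of_isGaussianProcess fun s => ?_
    refine ⟨{s, ⟨max r s, hr.le.trans (le_max_left r s)⟩}, .proj ⟨s, by simp⟩ -
      (R s (max r s) / R (max r s) (max r s)) •
        .proj ⟨⟨max r s, hr.le.trans (le_max_left r s)⟩, by simp⟩, fun ω => hξr r s ω⟩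
  have hXL (s : ℝ) (hs : 0 ≤ s) : MemLp (X s) 2 P := (hXG.hasGaussianLaw_eval ⟨s, hs⟩).memLp_two
  have hξL (s : ℝ) (hs : 0 ≤ s) : MemLp (ξr r s) 2 P :=
    (hξG.hasGaussianLaw_eval ⟨s, hs⟩).memLp_two
  have hXmean (s : ℝ) (hs : 0 ≤ s) : ∫ ω, X s ω ∂P = 0 := by
    obtain ⟨v, hv⟩ := hGauss 1 (fun _ => s) (fun _ => hs) (fun _ => 1)
    simp only [Finset.univ_unique, Finset.sum_const, Finset.card_singleton, one_smul,
      one_mul] at hv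
    rw [← integral_id_gaussianReal (μ := 0) (v := v), ← hv,
      integral_map (hXmeas s).aemeasurable (by fun_prop)]
  have hXcov (s s' : ℝ) (hs : 0 ≤ s) (hs' : 0 ≤ s') : cov[X s, X s'; P] = R s s' := by
    rw [covariance_eq_sub (hXL s hs) (hXL s' hs'), hXmean s hs, zero_mul, sub_zero, hR]
    rfl
  have hρr := hρpos r hr
  have hξcov (s s' : ℝ) (hs : 0 ≤ s) (hss' : s ≤ s') (hs' : s' < r) :
      cov[ξr r s, ξr r s'; P] = ρ s * (q s' - ρ s' * q r / ρ r) := by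
    have hξeq (x : ℝ) (hx : x < r) :
        ξr r x = fun ω => X x ω - R x r / R r r * X r ω := by
      ext ω
      rw [hξr, max_eq_left hx.le]
    have h0s' := hs.trans hss'
    rw [hξeq s (hss'.trans_lt hs'), hξeq s' hs',
      covariance_fun_sub_left (hXL s hs) ((hXL r hr.le).const_mul _)
        (hξeq s' hs' ▸ hξL s' h0s'),
      covariance_fun_sub_right (hXL s hs) (hXL s' h0s') ((hXL r hr.le).const_mul _),
      covariance_fun_sub_right ((hXL r hr.le).const_mul _) (hXL s' h0s')
        ((hXL r hr.le).const_mul _)]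
    simp only [covariance_const_mul_left, covariance_const_mul_right]
    rw [hXcov s s' hs h0s', hXcov s r hs hr.le, hXcov r s' hr.le h0s', hXcov r r hr.le hr.le,
      hfact s s' hs h0s', hfact s r hs hr.le, hfact r s' hr.le h0s', hfact r r hr.le hr.le,
      hfact s' r h0s' hr.le, min_eq_left hss', max_eq_right hss', min_eq_left (hss'.trans hs'.le),
      max_eq_right (hss'.trans hs'.le), min_eq_right hs'.le, max_eq_left hs'.le,
      min_eq_left hs'.le, max_eq_right hs'.le, min_self, max_self]
    field_simp
    ring
  have htr := htu.trans hur
  have hpos (ht0 : 0 < t) : q t - ρ t * q r / ρ r ≠ 0 := by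
    have h := hRnd t r ht0 hr htr.ne
    rw [hfact t r ht hr.le, hfact t t ht ht, hfact r r hr.le hr.le, min_eq_left htr.le,
      max_eq_right htr.le, min_self, max_self, min_self, max_self] at h
    have hρt := hρpos t ht0
    intro h0
    have h1 : q t = ρ t * q r / ρ r := by linarith
    rw [h1] at h
    refine h.ne ?_
    field_simp
  have hG := IsGaussianProcess.condExp_past_eq_of_covariance_eq_zero
    (Y := fun s : Ici (0 : ℝ) => ξr r s) (fun s => hξmeas s) (S := {s | (s : ℝ) ≤ t}) hξG
    (t := ⟨t, ht⟩) (u := ⟨u, ht.trans htu.le⟩) (show t ≤ t from le_rfl)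
    (a := (q u - ρ u * q r / ρ r) / (q t - ρ t * q r / ρ r)) ?_ hcomplete hgmeas hgbdd
  · rwa [show (⨆ s ∈ {s : Ici (0 : ℝ) | (s : ℝ) ≤ t},
        MeasurableSpace.comap (ξr r s) inferInstance) =
      ⨆ s ∈ Icc (0 : ℝ) t, MeasurableSpace.comap (ξr r s) inferInstance from
      le_antisymm
        (iSup₂_le fun s hs => le_iSup₂_of_le (s : ℝ) ⟨s.2, hs⟩ le_rfl)
        (iSup₂_le fun s hs => le_iSup₂_of_le (⟨s, hs.1⟩ : Ici (0 : ℝ)) hs.2 le_rfl)] at hG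
  · rintro ⟨s, hs⟩ (hst : s ≤ t)
    rw [covariance_fun_sub_right (hξL s hs) (hξL u (ht.trans htu.le)) ((hξL t ht).const_mul _),
      covariance_const_mul_right, hξcov s u hs (hst.trans htu.le) hur, hξcov s t hs hst htr]
    rcases ht.eq_or_lt with rfl | ht0
    · rw [le_antisymm hst hs, hρ0]
      ring
    · rw [mul_left_comm, div_mul_cancel₀ _ (hpos ht0), sub_self]
end

section
/- For every r > 0 and 0 < t < u < r: B_{t,u} > 0, B_{u,r} > 0 and B_{t,r} > 0 (so the covariance matrix of the Gaussian vector (ξ^r_t, ξ^r_u) is invertible), and for every bounded measurable g : ℝ → ℝ, ℙ-a.s., E[g(ξ^r_u) | σ(ξ^r_t)] = ∫_ℝ g(y) p(B_{t,u} B_{u,r}/B_{t,r}, y, (B_{u,r}/B_{t,r}) ξ^r_t) dy. -/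
open MeasureTheory ProbabilityTheory Real Set

/-- A pair of real random variables all of whose linear combinations are Gaussian has a Gaussian
law. -/
lemma hasGaussianLaw_prodMk_of_linearCombination {Ω : Type*} [MeasurableSpace Ω] {P : Measure Ω}
    {Y Z : Ω → ℝ} (hY : Measurable Y) (hZ : Measurable Z)
    (h : ∀ a b : ℝ, ∃ v : NNReal, P.map (fun ω => a * Y ω + b * Z ω) = gaussianReal 0 v) :
    HasGaussianLaw (fun ω => (Y ω, Z ω)) P := by
  refine ⟨isGaussian_of_map_eq_gaussianReal fun L => ?_⟩
  obtain ⟨v, hv⟩ := h (L (1, 0)) (L (0, 1))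
  refine ⟨0, v, ?_⟩
  rw [Measure.map_map (by fun_prop) (by fun_prop), ← hv]
  congr 1
  ext ω
  have hω : ((Y ω, Z ω) : ℝ × ℝ) = Y ω • (1, 0) + Z ω • (0, 1) := by ext <;> simp
  simp only [Function.comp_apply]
  rw [hω, map_add, map_smul, map_smul, smul_eq_mul, smul_eq_mul, mul_comm, mul_comm (Z ω)]

/-- If `Z` is independent of `Y`, the conditional expectation of `f (Y, Z)` given `Y` is obtained
by integrating out `Z`. -/
lemma condExp_prod_ae_eq_integral_map_of_indepFun {Ω : Type*} [MeasurableSpace Ω] {P : Measure Ω}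
    [IsProbabilityMeasure P] {Y Z : Ω → ℝ} (hY : Measurable Y) (hZ : Measurable Z)
    (hYZ : IndepFun Y Z P) {f : ℝ × ℝ → ℝ} (hf : StronglyMeasurable f)
    (hf_int : Integrable (fun ω => f (Y ω, Z ω)) P) :
    P[(fun ω => f (Y ω, Z ω))|MeasurableSpace.comap Y inferInstance] =ᵐ[P]
      fun ω => ∫ z, f (Y ω, z) ∂(P.map Z) := by
  have : IsProbabilityMeasure (P.map Z) := Measure.isProbabilityMeasure_map hZ.aemeasurable
  have hκ : condDistrib Z Y P =ᵐ[P.map Y] Kernel.const ℝ (P.map Z) := by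
    refine condDistrib_ae_eq_of_measure_eq_compProd Y hZ.aemeasurable ?_
    rw [Measure.compProd_const]
    exact (indepFun_iff_map_prod_eq_prod_map_map hY.aemeasurable hZ.aemeasurable).1 hYZ
  filter_upwards [condExp_prod_ae_eq_integral_condDistrib hY hZ.aemeasurable hf hf_int,
    ae_of_ae_map hY.aemeasurable hκ] with ω h₁ h₂
  rw [h₁, h₂, Kernel.const_apply]

/-- Conditional law of one component of a centered Gaussian pair given the other. -/
lemma condExp_comp_ae_eq_integral_gaussianPDFReal {Ω : Type*} [MeasurableSpace Ω] {P : Measure Ω}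
    [IsProbabilityMeasure P] {Y W : Ω → ℝ} (hY : Measurable Y) (hW : Measurable W)
    (h : ∀ a b : ℝ, ∃ v : NNReal, P.map (fun ω => a * Y ω + b * W ω) = gaussianReal 0 v)
    {m : ℝ} {v : NNReal} (hv : v ≠ 0) (hYW : ∫ ω, Y ω * W ω ∂P = m * ∫ ω, Y ω ^ 2 ∂P)
    (hWW : ∫ ω, W ω ^ 2 ∂P = m ^ 2 * ∫ ω, Y ω ^ 2 ∂P + v)
    {g : ℝ → ℝ} (hg : Measurable g) {C : ℝ} (hC : ∀ x, |g x| ≤ C) :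
    P[(fun ω => g (W ω))|MeasurableSpace.comap Y inferInstance] =ᵐ[P]
      fun ω => ∫ y, g y * gaussianPDFReal (m * Y ω) v y := by
  set Z : Ω → ℝ := fun ω => W ω - m * Y ω with hZdef
  have hZ : Measurable Z := by fun_prop
  have hcomb (a b : ℝ) :
      ∃ v : NNReal, P.map (fun ω => a * Y ω + b * Z ω) = gaussianReal 0 v := by
    obtain ⟨v', hv'⟩ := h (a - b * m) b
    refine ⟨v', hv' ▸ ?_⟩
    congr 1
    ext ω
    simp only [hZdef]
    ring
  have hlaw := hasGaussianLaw_prodMk_of_linearCombination hY hZ hcomb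
  have hlaw' := hasGaussianLaw_prodMk_of_linearCombination hY hW h
  have hY2 : MemLp Y 2 P := hlaw.fst.memLp_two
  have hZ2 : MemLp Z 2 P := hlaw.snd.memLp_two
  have hW2 : MemLp W 2 P := hlaw'.snd.memLp_two
  have hYYi : Integrable (fun ω => Y ω ^ 2) P := hY2.integrable_sq
  have hWWi : Integrable (fun ω => W ω ^ 2) P := hW2.integrable_sq
  have hYWi : Integrable (fun ω => Y ω * W ω) P := hY2.integrable_mul hW2
  obtain ⟨v₁, hv₁⟩ : ∃ v : NNReal, P.map Y = gaussianReal 0 v := by simpa using hcomb 1 0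
  obtain ⟨v₂, hv₂⟩ : ∃ v : NNReal, P.map Z = gaussianReal 0 v := by simpa using hcomb 0 1
  have hYmean : ∫ ω, Y ω ∂P = 0 := by
    rw [← integral_map (f := fun x => x) hY.aemeasurable (by fun_prop), hv₁,
      integral_id_gaussianReal]
  have hZmean : ∫ ω, Z ω ∂P = 0 := by
    rw [← integral_map (f := fun x => x) hZ.aemeasurable (by fun_prop), hv₂,
      integral_id_gaussianReal]
  have hcov : cov[Y, Z; P] = 0 := by
    rw [covariance_eq_sub hY2 hZ2, hYmean, zero_mul, sub_zero]
    calc ∫ ω, (Y * Z) ω ∂P = ∫ ω, (Y ω * W ω - m * Y ω ^ 2) ∂P := by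
          congr 1; ext ω; simp only [hZdef, Pi.mul_apply]; ring
      _ = 0 := by rw [integral_sub hYWi (hYYi.const_mul m), integral_const_mul, hYW, sub_self]
  have hv₂v : v₂ = v := by
    have hvar : Var[Z; P] = v := by
      rw [variance_of_integral_eq_zero hZ.aemeasurable hZmean]
      calc ∫ ω, Z ω ^ 2 ∂P = ∫ ω, (W ω ^ 2 - 2 * m * (Y ω * W ω) + m ^ 2 * Y ω ^ 2) ∂P := by
            congr 1; ext ω; simp only [hZdef]; ring
        _ = v := by
            have hsub : Integrable (fun ω => W ω ^ 2 - 2 * m * (Y ω * W ω)) P :=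
              hWWi.sub (hYWi.const_mul _)
            rw [integral_add hsub (hYYi.const_mul _),
              integral_sub hWWi (hYWi.const_mul _), integral_const_mul, integral_const_mul,
              hYW, hWW]
            ring
    have hvar' : Var[Z; P] = v₂ := by
      rw [← variance_id_map hZ.aemeasurable, hv₂, variance_id_gaussianReal]
    exact NNReal.coe_injective (hvar'.symm.trans hvar)
  have hind := hlaw.indepFun_of_covariance_eq_zero hcov
  have hgm : Measurable fun x : ℝ × ℝ => g (x.2 + m * x.1) := by fun_prop
  have hW_eq : (fun ω => g (W ω)) = fun ω => g (Z ω + m * Y ω) := by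
    ext ω; simp [hZdef]
  rw [hW_eq]
  have hint : Integrable (fun ω => g (Z ω + m * Y ω)) P :=
    Integrable.of_bound (by exact (hg.comp (by fun_prop)).aestronglyMeasurable) C (.of_forall fun ω => hC _)
  filter_upwards [condExp_prod_ae_eq_integral_map_of_indepFun hY hZ hind hgm.stronglyMeasurable
    hint] with ω hω
  rw [hω, hv₂, hv₂v]
  have hshift : gaussianReal (m * Y ω) v = (gaussianReal 0 v).map (· + m * Y ω) := by
    rw [gaussianReal_map_add_const, zero_add]
  rw [← integral_map (φ := fun z => z + m * Y ω) (f := g) (by fun_prop)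
    hg.aestronglyMeasurable, ← hshift, integral_gaussianReal_eq_integral_smul hv]
  simp only [smul_eq_mul, mul_comm]

/-- For 0 < t < u < r: B_{t,u}, B_{u,r}, B_{t,r} > 0 and the transition kernel of the
bridge: E[g(ξ^r_u) | σ(ξ^r_t)] = ∫ g(y) p(B_{t,u}B_{u,r}/B_{t,r}, y, (B_{u,r}/B_{t,r}) ξ^r_t) dy. -/
theorem stmt_9
    {Ω : Type*} [MeasurableSpace Ω] (P : Measure Ω) [IsProbabilityMeasure P]
    (X : ℝ → Ω → ℝ)
    (hXmeas : ∀ t, Measurable (X t))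
    (hGauss : ∀ (m : ℕ) (ts : Fin m → ℝ), (∀ i, 0 ≤ ts i) → ∀ c : Fin m → ℝ,
      ∃ v : NNReal, Measure.map (fun ω => ∑ i, c i * X (ts i) ω) P = gaussianReal 0 v)
    (hXcont : ∀ ω, ContinuousOn (fun t => X t ω) (Set.Ici 0))
    (hX0 : ∀ᵐ ω ∂P, X 0 ω = 0)
    (R : ℝ → ℝ → ℝ)
    (hR : ∀ s t, R s t = ∫ ω, X s ω * X t ω ∂P)
    (hRpos : ∀ t, 0 < t → 0 < R t t)
    (hRnd : ∀ s t, 0 < s → 0 < t → s ≠ t → (R s t)^2 < R s s * R t t)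
    (ξr : ℝ → ℝ → Ω → ℝ)
    (hξr : ∀ r t ω, ξr r t ω = X t ω - R t (max r t) / R (max r t) (max r t) * X (max r t) ω)
    (ρ q : ℝ → ℝ)
    (hfact : ∀ s t, 0 ≤ s → 0 ≤ t → R s t = ρ (min s t) * q (max s t))
    (hρcont : ContinuousOn ρ (Set.Ici 0)) (hqcont : ContinuousOn q (Set.Ici 0))
    (hρ0 : ρ 0 = 0)
    (hρpos : ∀ t, 0 < t → 0 < ρ t) (hqpos : ∀ t, 0 < t → 0 < q t)
    (hρq : MonotoneOn (fun t => ρ t / q t) (Set.Ioi 0))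
    (B : ℝ → ℝ → ℝ)
    (hB : ∀ s t, B s t = ρ (max s t) * q (min s t) - ρ (min s t) * q (max s t))
    (p : ℝ → ℝ → ℝ → ℝ)
    (hp : ∀ v x y, 0 < v →
      p v x y = (Real.sqrt (2 * Real.pi * v))⁻¹ * Real.exp (-(x - y)^2 / (2*v)))
    (r t u : ℝ) (ht : 0 < t) (htu : t < u) (hur : u < r) :
    0 < B t u ∧ 0 < B u r ∧ 0 < B t r ∧
    ∀ (g : ℝ → ℝ), Measurable g → (∃ C, ∀ x, |g x| ≤ C) →
      P[(fun ω => g (ξr r u ω))|MeasurableSpace.comap (ξr r t) inferInstance] =ᵐ[P]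
        fun ω => ∫ y, g y * p (B t u * B u r / B t r) y (B u r / B t r * ξr r t ω) := by
  have hr : 0 < r := by linarith
  have hu : 0 < u := ht.trans htu
  have hBlt {a b : ℝ} (hab : a < b) : B a b = ρ b * q a - ρ a * q b := by
    rw [hB, max_eq_right hab.le, min_eq_left hab.le]
  have hBpos {a b : ℝ} (ha : 0 < a) (hab : a < b) : 0 < B a b := by
    have hb := ha.trans hab
    have h := hRnd a b ha hb hab.ne
    rw [hfact a b ha.le hb.le, hfact a a ha.le ha.le, hfact b b hb.le hb.le,
      min_eq_left hab.le, max_eq_right hab.le, min_self, max_self, min_self, max_self] at h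
    have h' : (ρ a * q b) * (ρ a * q b) < (ρ a * q b) * (ρ b * q a) := by linarith
    rw [hBlt hab]
    linarith [lt_of_mul_lt_mul_left h' (mul_pos (hρpos a ha) (hqpos b hb)).le]
  have hBtu := hBpos ht htu
  have hBur := hBpos hu hur
  have hBtr := hBpos ht (htu.trans hur)
  refine ⟨hBtu, hBur, hBtr, fun g hg ⟨C, hC⟩ => ?_⟩
  have hρr := hρpos r hr
  have hqr := hqpos r hr
  have hξ {s : ℝ} (hs : 0 < s) (hsr : s < r) :
      ξr r s = fun ω => X s ω - ρ s / ρ r * X r ω := by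
    ext ω
    rw [hξr, max_eq_left hsr.le, hfact s r hs.le hr.le, hfact r r hr.le hr.le, min_eq_left hsr.le,
      max_eq_right hsr.le, min_self, max_self, mul_div_mul_right _ _ hqr.ne']
  have hX2 {s : ℝ} (hs : 0 < s) : MemLp (X s) 2 P := by
    obtain ⟨v, hv⟩ := hGauss 1 (fun _ => s) (fun _ => hs.le) (fun _ => 1)
    simp only [Finset.univ_unique, Finset.sum_singleton, one_mul] at hv
    exact HasGaussianLaw.memLp_two ⟨hv ▸ inferInstance⟩
  have hcov {a b : ℝ} (ha : 0 < a) (hab : a ≤ b) (hbr : b < r) :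
      ∫ ω, ξr r a ω * ξr r b ω ∂P = ρ a / ρ r * B b r := by
    have hb := ha.trans_le hab
    have hi {s s' : ℝ} (hs : 0 < s) (hs' : 0 < s') : Integrable (fun ω => X s ω * X s' ω) P :=
      (hX2 hs).integrable_mul (hX2 hs')
    rw [hξ ha (hab.trans_lt hbr), hξ hb hbr]
    calc _ = ∫ ω, (X a ω * X b ω - ρ b / ρ r * (X a ω * X r ω) - ρ a / ρ r * (X b ω * X r ω)
            + ρ a / ρ r * (ρ b / ρ r) * (X r ω * X r ω)) ∂P := by
          congr 1; ext ω; ring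
      _ = R a b - ρ b / ρ r * R a r - ρ a / ρ r * R b r + ρ a / ρ r * (ρ b / ρ r) * R r r := by
          have h₁ : Integrable (fun ω => X a ω * X b ω - ρ b / ρ r * (X a ω * X r ω)) P :=
            (hi ha hb).sub ((hi ha hr).const_mul _)
          have h₂ : Integrable (fun ω => X a ω * X b ω - ρ b / ρ r * (X a ω * X r ω)
              - ρ a / ρ r * (X b ω * X r ω)) P := h₁.sub ((hi hb hr).const_mul _)
          rw [integral_add h₂ ((hi hr hr).const_mul _), integral_sub h₁ ((hi hb hr).const_mul _),
            integral_sub (hi ha hb) ((hi ha hr).const_mul _)]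
          simp only [integral_const_mul, hR]
      _ = _ := by
          rw [hfact a b ha.le hb.le, hfact a r ha.le hr.le, hfact b r hb.le hr.le,
            hfact r r hr.le hr.le, min_eq_left hab, max_eq_right hab,
            min_eq_left (hab.trans hbr.le), max_eq_right (hab.trans hbr.le), min_eq_left hbr.le,
            max_eq_right hbr.le, min_self, max_self, hBlt hbr]
          field_simp
          ring
  have hξmeas (s : ℝ) : Measurable (ξr r s) := by
    have : ξr r s = fun ω => X s ω - R s (max r s) / R (max r s) (max r s) * X (max r s) ω :=
      funext (hξr r s)
    rw [this]
    exact (hXmeas _).sub ((hXmeas _).const_mul _)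
  have hcomb (a b : ℝ) :
      ∃ v : NNReal, P.map (fun ω => a * ξr r t ω + b * ξr r u ω) = gaussianReal 0 v := by
    obtain ⟨v, hv⟩ := hGauss 3 ![t, u, r]
      (by intro i; fin_cases i <;> simp [ht.le, hu.le, hr.le])
      ![a, b, -(a * (ρ t / ρ r) + b * (ρ u / ρ r))]
    refine ⟨v, hv ▸ ?_⟩
    congr 1
    ext ω
    simp only [hξ ht (htu.trans hur), hξ hu hur, Fin.sum_univ_three, Matrix.cons_val]
    ring
  have hvpos : 0 < B t u * B u r / B t r := by positivity
  have hvar {s : ℝ} (hs : 0 < s) (hsr : s < r) : ∫ ω, ξr r s ω ^ 2 ∂P = ρ s / ρ r * B s r := by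
    simp only [sq, hcov hs le_rfl hsr]
  have key := condExp_comp_ae_eq_integral_gaussianPDFReal (hξmeas t) (hξmeas u) hcomb
    (m := B u r / B t r) (v := (B t u * B u r / B t r).toNNReal)
    (Real.toNNReal_pos.2 hvpos).ne'
    (by rw [hcov ht htu.le hur, hvar ht (htu.trans hur)]; field_simp)
    (by
      rw [hvar hu hur, hvar ht (htu.trans hur), Real.coe_toNNReal _ hvpos.le]
      field_simp
      rw [hBlt htu, hBlt hur, hBlt (htu.trans hur)]
      ring) hg hC
  refine key.trans (.of_forall fun ω => ?_)
  simp only [hp _ _ _ hvpos, gaussianPDFReal_def, Real.coe_toNNReal _ hvpos.le]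
end

section
/- Let n ≥ 2, r > 0 and 0 < t_1 < t_2 < … < t_n < r. Then the law of the random vector (ξ^r_{t_1}, …, ξ^r_{t_n}) on ℝⁿ is absolutely continuous with respect to Lebesgue measure, with density φ(x_1,…,x_n) = (2π)^{−n/2} ( ρ(r)/(ρ(t_1) B_{t_n,r}) · ∏_{k=2}^n 1/B_{t_{k−1},t_k} )^{1/2} · exp[ −(1/2)(ρ(t_2)/(ρ(t_1) B_{t_1,t_2})) x_1² − (1/2) ∑_{k=2}^{n−1} (B_{t_{k−1},t_{k+1}}/(B_{t_{k−1},t_k} B_{t_k,t_{k+1}})) x_k² + ∑_{k=1}^{n−1} x_k x_{k+1}/B_{t_k,t_{k+1}} − (1/2)(B_{t_{n−1},r}/(B_{t_n,r} B_{t_{n−1},t_n})) x_n² ]. -/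
open MeasureTheory ProbabilityTheory Real Set

/-- A product of measures with real integrable densities has the product density. -/
lemma pi_withDensity_ofReal {ι : Type*} [Fintype ι] (f : ι → ℝ → ℝ)
    (hint : ∀ i, Integrable (f i)) (hnn : ∀ i x, 0 ≤ f i x) :
    Measure.pi (fun i => (volume : Measure ℝ).withDensity fun x => ENNReal.ofReal (f i x)) =
      (volume : Measure (ι → ℝ)).withDensity fun x => ENNReal.ofReal (∏ i, f i (x i)) := by
  refine Measure.pi_eq fun s hs => ?_
  rw [withDensity_apply _ (MeasurableSet.univ_pi hs), volume_pi, Measure.restrict_pi_pi,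
    ← ofReal_integral_eq_lintegral_ofReal
      (Integrable.fintype_prod fun i => (hint i).integrableOn)
      (.of_forall fun x => Finset.prod_nonneg fun i _ => hnn i _),
    integral_fintype_prod_eq_prod,
    ENNReal.ofReal_prod_of_nonneg fun i _ => integral_nonneg (hnn i)]
  refine Finset.prod_congr rfl fun i _ => ?_
  rw [withDensity_apply _ (hs i), ofReal_integral_eq_lintegral_ofReal (hint i).integrableOn
    (.of_forall (hnn i))]

lemma pi_gaussianReal_eq_withDensity {ι : Type*} [Fintype ι] (v : ι → NNReal)
    (hv : ∀ i, v i ≠ 0) :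
    Measure.pi (fun i => gaussianReal 0 (v i)) =
      (volume : Measure (ι → ℝ)).withDensity fun x =>
        ENNReal.ofReal (∏ i, gaussianPDFReal 0 (v i) (x i)) := by
  rw [← pi_withDensity_ofReal _
    (fun i => integrable_gaussianPDFReal 0 (v i)) (fun i => gaussianPDFReal_nonneg 0 (v i))]
  congr 1 with i : 1
  rw [gaussianReal_of_var_ne_zero 0 (hv i), gaussianPDF_def]

/-- If the image of `μ` under a linear map of determinant one has density `g`, then `μ` has
density `g ∘ T`. -/
lemma eq_withDensity_comp_of_map_eq {ι : Type*} [Fintype ι] (T : (ι → ℝ) →ₗ[ℝ] (ι → ℝ))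
    (hdet : LinearMap.det T = 1) {μ : Measure (ι → ℝ)} {g : (ι → ℝ) → ENNReal}
    (hg : Measurable g) (h : μ.map T = volume.withDensity g) :
    μ = volume.withDensity (g ∘ T) := by
  have hT : Measurable T := T.continuous_of_finiteDimensional.measurable
  have hpres : (volume : Measure (ι → ℝ)).map T = volume := by
    rw [Measure.map_linearMap_addHaar_pi_eq_smul_addHaar (by simp [hdet])]
    simp [hdet]
  let e := LinearMap.equivOfDetNeZero T (by simp [hdet])
  have hS : Measurable e.symm :=
    (e.symm : (ι → ℝ) →ₗ[ℝ] (ι → ℝ)).continuous_of_finiteDimensional.measurable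
  have hST : e.symm ∘ T = id := funext fun x => e.symm_apply_apply x
  have hcomp : (volume.withDensity (g ∘ T)).map T = volume.withDensity g := by
    ext s hs
    rw [Measure.map_apply hT hs, withDensity_apply _ (hT hs), withDensity_apply _ hs]
    nth_rw 2 [← hpres]
    rw [setLIntegral_map hs hg hT]
    rfl
  have hmap := congrArg (Measure.map e.symm) (h.trans hcomp.symm)
  rwa [Measure.map_map hS hT, Measure.map_map hS hT, hST, Measure.map_id, Measure.map_id] at hmap

/-- The linear map `x ↦ (x_i - a_i x_{i+1})_i`, with the convention that the coordinate after the
last one vanishes. -/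
def backwardInnovation {n : ℕ} (a : Fin n → ℝ) : (Fin n → ℝ) →ₗ[ℝ] (Fin n → ℝ) where
  toFun x i := x i - a i * (Fin.snoc x 0 : Fin (n + 1) → ℝ) i.succ
  map_add' x y := by
    ext i
    rcases Fin.eq_castSucc_or_eq_last i.succ with ⟨k, hk⟩ | hk
    · simp [hk]; ring
    · simp [hk]
  map_smul' c x := by
    ext i
    rcases Fin.eq_castSucc_or_eq_last i.succ with ⟨k, hk⟩ | hk
    · simp [hk]; ring
    · simp [hk]

lemma backwardInnovation_apply {n : ℕ} (a : Fin n → ℝ) (x : Fin n → ℝ) (i : Fin n) :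
    backwardInnovation a x i = x i - a i * (Fin.snoc x 0 : Fin (n + 1) → ℝ) i.succ := rfl

lemma det_backwardInnovation {n : ℕ} (a : Fin n → ℝ) :
    LinearMap.det (backwardInnovation a) = 1 := by
  have hentry : ∀ i j, j ≤ i →
      LinearMap.toMatrix' (backwardInnovation a) i j = (Pi.single j 1 : Fin n → ℝ) i := by
    intro i j hij
    rw [LinearMap.toMatrix'_apply, backwardInnovation_apply]
    rcases Fin.eq_castSucc_or_eq_last i.succ with ⟨k, hk⟩ | hk
    · have hkj : k ≠ j := by
        rintro rfl
        have := congrArg Fin.val hk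
        simp at this
        omega
      simp [hk, hkj]
    · simp [hk]
  rw [← LinearMap.det_toMatrix', Matrix.det_of_isUpperTriangular]
  · simp [hentry]
  · intro i j hij
    rw [hentry i j (le_of_lt hij)]
    exact Pi.single_eq_of_ne (ne_of_gt hij) _

/-- Random variables all of whose linear combinations are Gaussian are jointly Gaussian. -/
lemma hasGaussianLaw_of_sum_eq_gaussianReal {Ω : Type*} [MeasurableSpace Ω] {P : Measure Ω}
    {n : ℕ} {Z : Fin n → Ω → ℝ} (hZ : ∀ i, Measurable (Z i))
    (h : ∀ c : Fin n → ℝ, ∃ v : NNReal,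
      Measure.map (fun ω => ∑ i, c i * Z i ω) P = gaussianReal 0 v) :
    HasGaussianLaw (fun ω i => Z i ω) P := by
  refine ⟨isGaussian_of_map_eq_gaussianReal fun L => ?_⟩
  obtain ⟨v, hv⟩ := h fun i => L (Pi.single i 1)
  refine ⟨0, v, ?_⟩
  rw [← hv, Measure.map_map (by fun_prop) (measurable_pi_lambda _ hZ)]
  congr 1 with ω
  have := LinearMap.pi_apply_eq_sum_univ (L : (Fin n → ℝ) →ₗ[ℝ] ℝ) (fun i => Z i ω)
  simp only [ContinuousLinearMap.coe_coe, smul_eq_mul] at this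
  simp only [Function.comp_apply, this]
  refine Finset.sum_congr rfl fun i _ => ?_
  rw [mul_comm]
  congr 2
  ext j
  simp [Pi.single_apply, eq_comm]

/-- The backward innovations of a centered Gaussian vector with covariances `p_i q_j`, `i ≤ j`,
are independent centered Gaussian variables. -/
lemma map_innovation_eq_pi {Ω : Type*} [MeasurableSpace Ω] {P : Measure Ω}
    [IsProbabilityMeasure P] {n : ℕ} {Z : Fin (n + 1) → Ω → ℝ}
    (hG : HasGaussianLaw (fun ω i => Z i ω) P)
    (p q : Fin (n + 1) → ℝ) (hp : ∀ i, p i ≠ 0)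
    (hcov : ∀ i j, i ≤ j → cov[Z i, Z j; P] = p i * q j) (hmean : ∀ i, P[Z i] = 0) :
    P.map (fun ω (i : Fin n) => Z i.castSucc ω - p i.castSucc / p i.succ * Z i.succ ω) =
      Measure.pi fun i : Fin n => gaussianReal 0 (Real.toNNReal
        (p i.castSucc * (p i.succ * q i.castSucc - p i.castSucc * q i.succ) / p i.succ)) := by
  have hL : ∀ i, MemLp (Z i) 2 P := fun i => (hG.eval i).memLp_two
  have hYG : HasGaussianLaw
      (fun ω (i : Fin n) => Z i.castSucc ω - p i.castSucc / p i.succ * Z i.succ ω) P := by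
    let L : (Fin (n + 1) → ℝ) →L[ℝ] (Fin n → ℝ) := ContinuousLinearMap.pi fun i =>
      ContinuousLinearMap.proj i.castSucc - (p i.castSucc / p i.succ) •
        ContinuousLinearMap.proj i.succ
    exact hG.map_fun L
  have hcovY : ∀ i j : Fin n, i ≤ j →
      cov[fun ω => Z i.castSucc ω - p i.castSucc / p i.succ * Z i.succ ω,
        fun ω => Z j.castSucc ω - p j.castSucc / p j.succ * Z j.succ ω; P] =
      if i = j then
        p i.castSucc * (p i.succ * q i.castSucc - p i.castSucc * q i.succ) / p i.succ
      else 0 := by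
    intro i j hij
    rw [covariance_fun_sub_fun_sub (hL _) ((hL _).const_mul _) (hL _) ((hL _).const_mul _)]
    simp only [covariance_const_mul_left, covariance_const_mul_right]
    have h1 := hp i.succ
    have h2 := hp j.succ
    split_ifs with h
    · subst h
      rw [covariance_comm (Z i.succ) (Z i.castSucc), hcov _ _ le_rfl, hcov _ _ le_rfl,
        hcov _ _ i.castSucc_lt_succ.le]
      field_simp
      ring
    · have hlt : i.succ ≤ j.castSucc := Fin.succ_le_castSucc_iff.2 (lt_of_le_of_ne hij h)
      rw [hcov _ _ hlt, hcov _ _ (hlt.trans j.castSucc_lt_succ.le),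
        hcov _ _ (i.castSucc_lt_succ.le.trans hlt),
        hcov _ _ ((i.castSucc_lt_succ.le.trans hlt).trans j.castSucc_lt_succ.le)]
      field_simp
      ring
  have hind := hYG.iIndepFun_of_covariance_eq_zero fun i j hij => by
    rcases lt_or_gt_of_ne hij with h | h
    · rw [hcovY i j h.le, if_neg hij]
    · rw [covariance_comm, hcovY j i h.le, if_neg hij.symm]
  rw [hind.map_fun_eq_pi_map fun i => (hYG.eval i).aemeasurable]
  congr 1 with i : 1
  rw [(hYG.eval i).map_eq_gaussianReal]
  congr 1
  · rw [integral_sub (hG.eval _).integrable ((hG.eval _).integrable.const_mul _),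
      integral_const_mul, hmean, hmean]
    simp
  · rw [← covariance_self (hYG.eval i).aemeasurable, hcovY i i le_rfl, if_pos rfl]

/-- Normalizing constant of the product density. -/
lemma prod_inv_sqrt_innovation_variance {m : ℕ} (p : Fin (m + 3) → ℝ) (b : Fin (m + 2) → ℝ)
    (hp : ∀ i, 0 < p i) (hb : ∀ i, 0 < b i) :
    ∏ i : Fin (m + 2), (√(2 * π * (p i.castSucc * b i / p i.succ)))⁻¹ =
      (2 * π) ^ (-((m : ℝ) + 2) / 2) *
        √(p (Fin.last _) / (p 0 * b (Fin.last _)) * ∏ i : Fin (m + 1), 1 / b i.castSucc) := by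
  have htel : (∏ i : Fin (m + 2), p i.castSucc) * p (Fin.last _) =
      p 0 * ∏ i : Fin (m + 2), p i.succ := by
    rw [← Fin.prod_univ_castSucc, Fin.prod_univ_succ]
  have h1 : ∏ i : Fin (m + 2), p i.castSucc ≠ 0 :=
    Finset.prod_ne_zero_iff.2 fun i _ => (hp _).ne'
  have h2 : ∏ i : Fin (m + 1), b i.castSucc ≠ 0 :=
    Finset.prod_ne_zero_iff.2 fun i _ => (hb _).ne'
  have hpow : ((2 * π) ^ (-((m : ℝ) + 2) / 2)) = √(((2 * π) ^ (m + 2))⁻¹) := by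
    rw [Real.sqrt_eq_rpow, ← Real.rpow_natCast, ← Real.rpow_neg (by positivity),
      ← Real.rpow_mul (by positivity)]
    congr 1
    push_cast
    ring
  rw [hpow, ← Real.sqrt_mul (by positivity)]
  simp_rw [← Real.sqrt_inv]
  rw [← Real.sqrt_prod _ fun i _ =>
    inv_nonneg.2 (by have := hp i.castSucc; have := hp i.succ; have := hb i; positivity)]
  congr 1
  have h3 : ∏ i : Fin (m + 2), p i.succ ≠ 0 :=
    Finset.prod_ne_zero_iff.2 fun i _ => (hp _).ne'
  have h4 := (hp 0).ne'
  have h5 := (hb (Fin.last _)).ne'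
  have h6 : ∏ i : Fin (m + 2), (2 * π * (p i.castSucc * b i / p i.succ)) = (2 * π) ^ (m + 2) *
      ((∏ i : Fin (m + 2), p i.castSucc) * ((∏ i : Fin (m + 1), b i.castSucc) * b (Fin.last _)) /
        ∏ i : Fin (m + 2), p i.succ) := by
    rw [← Fin.prod_univ_castSucc, ← Finset.prod_mul_distrib, ← Finset.prod_div_distrib,
      Finset.prod_mul_distrib, Finset.prod_const, Finset.card_univ, Fintype.card_fin]
  rw [Finset.prod_inv_distrib, h6, Finset.prod_div_distrib, Finset.prod_const_one]
  field_simp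
  linear_combination -htel

/-- Expansion of the quadratic form of the product density. -/
lemma sum_innovation_sq_div_variance {m : ℕ} (p q : Fin (m + 3) → ℝ)
    (D : Fin (m + 3) → Fin (m + 3) → ℝ) (hD : ∀ i j, D i j = p j * q i - p i * q j)
    (hp : ∀ i, 0 < p i) (hb : ∀ i : Fin (m + 2), 0 < D i.castSucc i.succ) (x : Fin (m + 2) → ℝ) :
    ∑ i : Fin (m + 2), -(x i - p i.castSucc / p i.succ *
        (Fin.snoc x 0 : Fin (m + 3) → ℝ) i.succ) ^ 2 /
          (2 * (p i.castSucc * D i.castSucc i.succ / p i.succ)) =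
      -(1/2) * (p 1 / (p 0 * D 0 1)) * x 0 ^ 2
      - (1/2) * ∑ j : Fin m,
          D j.castSucc.castSucc.castSucc j.succ.succ.castSucc /
            (D j.castSucc.castSucc.castSucc j.succ.castSucc.castSucc *
              D j.succ.castSucc.castSucc j.succ.succ.castSucc) * x j.succ.castSucc ^ 2
      + ∑ i : Fin (m + 1), x i.castSucc * x i.succ / D i.castSucc.castSucc i.succ.castSucc
      - (1/2) * (D (Fin.last m).castSucc.castSucc (Fin.last _) /
          (D (Fin.last (m + 1)).castSucc (Fin.last _) *
            D (Fin.last m).castSucc.castSucc (Fin.last (m + 1)).castSucc)) *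
          x (Fin.last (m + 1)) ^ 2 := by
  have hterm : ∀ i : Fin (m + 1), -(x i.castSucc - p i.castSucc.castSucc / p i.castSucc.succ *
        (Fin.snoc x 0 : Fin (m + 3) → ℝ) i.castSucc.succ) ^ 2 /
          (2 * (p i.castSucc.castSucc * D i.castSucc.castSucc i.castSucc.succ /
            p i.castSucc.succ)) =
      -(1/2) * (p i.succ.castSucc / (p i.castSucc.castSucc *
          D i.castSucc.castSucc i.succ.castSucc)) * x i.castSucc ^ 2
      + x i.castSucc * x i.succ / D i.castSucc.castSucc i.succ.castSucc
      - (1/2) * (p i.castSucc.castSucc / (p i.succ.castSucc *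
          D i.castSucc.castSucc i.succ.castSucc)) * x i.succ ^ 2 := by
    intro i
    have h1 := (hp i.castSucc.castSucc).ne'
    have h2 := (hp i.succ.castSucc).ne'
    have h3 := (hb i.castSucc).ne'
    rw [Fin.succ_castSucc i] at *
    rw [Fin.snoc_castSucc]
    field_simp
    ring
  have hcomb : ∀ i j k, p i ≠ 0 → p j ≠ 0 → D i j ≠ 0 → D j k ≠ 0 →
      D i k / (D i j * D j k) = p k / (p j * D j k) + p i / (p j * D i j) := by
    intro i j k h1 h2 h3 h4
    field_simp
    simp only [hD]
    ring
  rw [Fin.sum_univ_castSucc]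
  simp_rw [hterm]
  rw [Finset.sum_sub_distrib, Finset.sum_add_distrib, Fin.sum_univ_succ (n := m),
    Fin.sum_univ_castSucc (n := m)
      (f := fun i => (1/2) * (p i.castSucc.castSucc / (p i.succ.castSucc *
          D i.castSucc.castSucc i.succ.castSucc)) * x i.succ ^ 2)]
  have hmid : ∀ j : Fin m, D j.castSucc.castSucc.castSucc j.succ.succ.castSucc /
            (D j.castSucc.castSucc.castSucc j.succ.castSucc.castSucc *
              D j.succ.castSucc.castSucc j.succ.succ.castSucc) * x j.succ.castSucc ^ 2 =
      p j.succ.succ.castSucc / (p j.succ.castSucc.castSucc *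
          D j.succ.castSucc.castSucc j.succ.succ.castSucc) * x j.succ.castSucc ^ 2 +
      p j.castSucc.castSucc.castSucc / (p j.castSucc.succ.castSucc *
          D j.castSucc.castSucc.castSucc j.castSucc.succ.castSucc) * x j.castSucc.succ ^ 2 := by
    intro j
    rw [hcomb j.castSucc.castSucc.castSucc j.succ.castSucc.castSucc j.succ.succ.castSucc
      (hp _).ne' (hp _).ne' (hb j.castSucc.castSucc).ne' (hb j.succ.castSucc).ne', add_mul]
    rfl
  have hend := hcomb (Fin.last m).castSucc.castSucc (Fin.last (m + 1)).castSucc (Fin.last (m + 2))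
    (hp _).ne' (hp _).ne' (hb (Fin.last m).castSucc).ne' (hb (Fin.last (m + 1))).ne'
  have hlast : -(x (Fin.last (m + 1)) - p (Fin.last (m + 1)).castSucc / p (Fin.last (m + 1)).succ *
        (Fin.snoc x 0 : Fin (m + 3) → ℝ) (Fin.last (m + 1)).succ) ^ 2 /
        (2 * (p (Fin.last (m + 1)).castSucc * D (Fin.last (m + 1)).castSucc
          (Fin.last (m + 1)).succ / p (Fin.last (m + 1)).succ)) =
      -(1/2) * (p (Fin.last (m + 2)) / (p (Fin.last (m + 1)).castSucc *
        D (Fin.last (m + 1)).castSucc (Fin.last (m + 2)))) * x (Fin.last (m + 1)) ^ 2 := by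
    rw [Fin.succ_last, Fin.snoc_last]
    have h1 := (hp (Fin.last (m + 1)).castSucc).ne'
    have h2 := (hp (Fin.last (m + 2))).ne'
    have h3 : D (Fin.last (m + 1)).castSucc (Fin.last (m + 2)) ≠ 0 := (hb (Fin.last (m + 1))).ne'
    field_simp
    ring
  rw [hlast]
  simp_rw [hmid]
  rw [mul_comm (D (Fin.last (m + 1)).castSucc (Fin.last (m + 2))), hend, Finset.sum_add_distrib,
    Fin.succ_last]
  simp only [mul_assoc]
  simp only [← Finset.mul_sum]
  have e0 : (Fin.castSucc 0 : Fin (m + 2)) = 0 := rfl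
  have e1 : ((Fin.castSucc 0 : Fin (m + 2)).castSucc : Fin (m + 3)) = 0 := rfl
  have e2 : ((Fin.succ 0 : Fin (m + 2)).castSucc : Fin (m + 3)) = 1 := rfl
  rw [e1, e2, e0]
  ring

/-- Finite-dimensional density of the bridge: for n = m+2 ≥ 2 times
0 < t_1 < … < t_n < r, the law of (ξ^r_{t_1}, …, ξ^r_{t_n}) has the explicit Gaussian
density w.r.t. Lebesgue measure on ℝⁿ. -/
theorem stmt_11
    {Ω : Type*} [MeasurableSpace Ω] (P : Measure Ω) [IsProbabilityMeasure P]
    (X : ℝ → Ω → ℝ)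
    (hXmeas : ∀ t, Measurable (X t))
    (hGauss : ∀ (m : ℕ) (ts : Fin m → ℝ), (∀ i, 0 ≤ ts i) → ∀ c : Fin m → ℝ,
      ∃ v : NNReal, Measure.map (fun ω => ∑ i, c i * X (ts i) ω) P = gaussianReal 0 v)
    (hXcont : ∀ ω, ContinuousOn (fun t => X t ω) (Set.Ici 0))
    (hX0 : ∀ᵐ ω ∂P, X 0 ω = 0)
    (R : ℝ → ℝ → ℝ)
    (hR : ∀ s t, R s t = ∫ ω, X s ω * X t ω ∂P)
    (hRpos : ∀ t, 0 < t → 0 < R t t)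
    (hRnd : ∀ s t, 0 < s → 0 < t → s ≠ t → (R s t)^2 < R s s * R t t)
    (ξr : ℝ → ℝ → Ω → ℝ)
    (hξr : ∀ r t ω, ξr r t ω = X t ω - R t (max r t) / R (max r t) (max r t) * X (max r t) ω)
    (ρ q : ℝ → ℝ)
    (hfact : ∀ s t, 0 ≤ s → 0 ≤ t → R s t = ρ (min s t) * q (max s t))
    (hρcont : ContinuousOn ρ (Set.Ici 0)) (hqcont : ContinuousOn q (Set.Ici 0))
    (hρ0 : ρ 0 = 0)
    (hρpos : ∀ t, 0 < t → 0 < ρ t) (hqpos : ∀ t, 0 < t → 0 < q t)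
    (hρq : MonotoneOn (fun t => ρ t / q t) (Set.Ioi 0))
    (B : ℝ → ℝ → ℝ)
    (hB : ∀ s t, B s t = ρ (max s t) * q (min s t) - ρ (min s t) * q (max s t))
    (r : ℝ) (hr : 0 < r)
    (m : ℕ) (t : Fin (m + 2) → ℝ) (hmono : StrictMono t)
    (h0 : 0 < t 0) (hlast : t (Fin.last (m + 1)) < r) :
    Measure.map (fun ω => fun i : Fin (m + 2) => ξr r (t i) ω) P =
      (volume : Measure (Fin (m + 2) → ℝ)).withDensity (fun x => ENNReal.ofReal
        ((2 * Real.pi) ^ (-(((m : ℝ) + 2)) / 2) *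
          Real.sqrt (ρ r / (ρ (t 0) * B (t (Fin.last (m + 1))) r) *
            ∏ i : Fin (m + 1), 1 / B (t i.castSucc) (t i.succ)) *
          Real.exp (
            -(1/2) * (ρ (t 1) / (ρ (t 0) * B (t 0) (t 1))) * x 0 ^ 2
            - (1/2) * ∑ j : Fin m,
                B (t j.castSucc.castSucc) (t j.succ.succ) /
                  (B (t j.castSucc.castSucc) (t j.succ.castSucc) *
                    B (t j.succ.castSucc) (t j.succ.succ)) * x j.succ.castSucc ^ 2
            + ∑ i : Fin (m + 1), x i.castSucc * x i.succ / B (t i.castSucc) (t i.succ)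
            - (1/2) * (B (t (Fin.last m).castSucc) r /
                (B (t (Fin.last (m + 1))) r *
                  B (t (Fin.last m).castSucc) (t (Fin.last (m + 1))))) *
                x (Fin.last (m + 1)) ^ 2))) := by
  have htpos : ∀ i, 0 < t i := fun i => h0.trans_le (hmono.monotone (Fin.zero_le i))
  have htr : ∀ i, t i < r := fun i => (hmono.monotone (Fin.le_last i)).trans_lt hlast
  set s : Fin (m + 3) → ℝ := Fin.snoc t r with hs
  have hs_cast : ∀ i, s (Fin.castSucc i) = t i := fun i => by simp [hs]
  have hs_last : s (Fin.last _) = r := by simp [hs]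
  have hspos : ∀ i, 0 < s i := Fin.lastCases (by rwa [hs_last]) fun i => by
    rw [hs_cast]; exact htpos i
  have hsmono : StrictMono s := Fin.strictMono_iff_lt_succ.2 fun i => by
    rw [hs_cast]
    rcases Fin.eq_castSucc_or_eq_last i.succ with ⟨k, hk⟩ | hk
    · rw [hk, hs_cast]
      refine hmono ?_
      rw [Fin.lt_def]
      have := congrArg Fin.val hk
      simp at this
      omega
    · rw [hk, hs_last]; exact htr i
  set p : Fin (m + 3) → ℝ := fun i => ρ (s i)
  set Q : Fin (m + 3) → ℝ := fun i => q (s i)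
  have hp : ∀ i, 0 < p i := fun i => hρpos _ (hspos i)
  have hRs : ∀ i j, i ≤ j → R (s i) (s j) = p i * Q j := fun i j hij => by
    rw [hfact _ _ (hspos i).le (hspos j).le, min_eq_left (hsmono.monotone hij),
      max_eq_right (hsmono.monotone hij)]
  have hBs : ∀ i j, i ≤ j → B (s i) (s j) = p j * Q i - p i * Q j := fun i j hij => by
    rw [hB, min_eq_left (hsmono.monotone hij), max_eq_right (hsmono.monotone hij)]
  have hBpos : ∀ i j, i < j → 0 < p j * Q i - p i * Q j := fun i j hij => by
    have h := hRnd _ _ (hspos i) (hspos j) (hsmono hij).ne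
    rw [hRs i j hij.le, hRs i i le_rfl, hRs j j le_rfl] at h
    have h1 : 0 < p i * Q j := mul_pos (hp i) (hqpos _ (hspos j))
    nlinarith
  have hG : HasGaussianLaw (fun ω i => X (s i) ω) P :=
    hasGaussianLaw_of_sum_eq_gaussianReal (fun i => hXmeas _)
      (hGauss _ s fun i => (hspos i).le)
  have hmean : ∀ i, P[X (s i)] = 0 := fun i => by
    obtain ⟨v, hv⟩ := hGauss 1 (fun _ => s i) (fun _ => (hspos i).le) (fun _ => 1)
    simp only [Finset.univ_unique, one_mul, Finset.sum_singleton] at hv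
    have h := integral_map (μ := P) (hXmeas (s i)).aemeasurable
      (f := fun x : ℝ => x) (by fun_prop)
    rw [← h, hv, integral_id_gaussianReal]
  have hcov : ∀ i j, i ≤ j → cov[X (s i), X (s j); P] = p i * Q j := fun i j hij => by
    rw [covariance_eq_sub (hG.eval i).memLp_two (hG.eval j).memLp_two, hmean, hmean,
      ← hRs i j hij, hR]
    simp
  have hY := map_innovation_eq_pi hG p Q (fun i => (hp i).ne') hcov hmean
  have hvpos : ∀ i : Fin (m + 2),
      0 < p i.castSucc * (p i.succ * Q i.castSucc - p i.castSucc * Q i.succ) / p i.succ :=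
    fun i => div_pos (mul_pos (hp _) (hBpos _ _ i.castSucc_lt_succ)) (hp _)
  rw [pi_gaussianReal_eq_withDensity _ fun i => (Real.toNNReal_pos.2 (hvpos i)).ne'] at hY
  set a : Fin (m + 2) → ℝ := fun i => p i.castSucc / p i.succ with ha
  have hξ : ∀ ω j, (Fin.snoc (fun i => ξr r (t i) ω) 0 : Fin (m + 3) → ℝ) j =
      X (s j) ω - p j / p (Fin.last _) * X r ω := by
    intro ω j
    refine Fin.lastCases ?_ (fun i => ?_) j
    · rw [Fin.snoc_last, hs_last, div_self (hp _).ne', one_mul, sub_self]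
    · have hQ : Q (Fin.last _) ≠ 0 := (hqpos _ (hspos _)).ne'
      rw [Fin.snoc_castSucc, hξr, max_eq_left (htr i).le, ← hs_cast i, ← hs_last,
        hRs _ _ (Fin.le_last _), hRs _ _ le_rfl, mul_div_mul_right _ _ hQ]
  have hξmeas : Measurable fun ω (i : Fin (m + 2)) => ξr r (t i) ω := by
    refine measurable_pi_lambda _ fun i => ?_
    simp_rw [hξr]
    exact (hXmeas _).sub ((hXmeas _).const_mul _)
  have hT : (P.map fun ω (i : Fin (m + 2)) => ξr r (t i) ω).map (backwardInnovation a) =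
      P.map fun ω (i : Fin (m + 2)) => X (s i.castSucc) ω - a i * X (s i.succ) ω := by
    rw [Measure.map_map (backwardInnovation a).continuous_of_finiteDimensional.measurable hξmeas]
    congr 1 with ω i
    have h1 : ξr r (t i) ω = X (s i.castSucc) ω - p i.castSucc / p (Fin.last _) * X r ω := by
      rw [← hξ, Fin.snoc_castSucc]
    have h2 := (hp i.succ).ne'
    rw [Function.comp_apply, backwardInnovation_apply, hξ, h1, ha]
    field_simp
    ring
  rw [eq_withDensity_comp_of_map_eq _ (det_backwardInnovation a)
    (Measurable.ennreal_ofReal <| Finset.measurable_prod _ fun i _ =>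
      (measurable_gaussianPDFReal _ _).comp (measurable_pi_apply i)) (hT.trans hY)]
  congr 1 with x
  rw [Function.comp_apply]
  congr 1
  simp_rw [Function.comp_apply, gaussianPDFReal_def, sub_zero, Real.coe_toNNReal _ (hvpos _).le]
  have hb : ∀ i : Fin (m + 2), 0 < p i.succ * Q i.castSucc - p i.castSucc * Q i.succ :=
    fun i => hBpos _ _ i.castSucc_lt_succ
  rw [Finset.prod_mul_distrib, ← Real.exp_sum,
    prod_inv_sqrt_innovation_variance p
      (fun i => p i.succ * Q i.castSucc - p i.castSucc * Q i.succ) hp hb]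
  simp_rw [backwardInnovation_apply, ha]
  rw [sum_innovation_sq_div_variance p Q (fun i j => p j * Q i - p i * Q j)
    (fun _ _ => rfl) hp hb x]
  have hBt : ∀ i j : Fin (m + 2), i ≤ j →
      B (t i) (t j) = p j.castSucc * Q i.castSucc - p i.castSucc * Q j.castSucc := fun i j hij => by
    rw [← hs_cast, ← hs_cast, hBs _ _ (Fin.castSucc_le_castSucc_iff.2 hij)]
  have hBr : ∀ i : Fin (m + 2),
      B (t i) r = p (Fin.last _) * Q i.castSucc - p i.castSucc * Q (Fin.last _) := fun i => by
    rw [← hs_cast, ← hBs _ _ (Fin.le_last _), hs_last]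
  have hρt : ∀ i : Fin (m + 2), ρ (t i) = p i.castSucc := fun i => by rw [← hs_cast]
  have hρr : ρ r = p (Fin.last _) := by rw [← hs_last]
  have e1 : ((1 : Fin (m + 2)).castSucc : Fin (m + 3)) = 1 := rfl
  have e2 : ((0 : Fin (m + 2)).castSucc : Fin (m + 3)) = 0 := rfl
  have hsucc : ∀ i : Fin (m + 1), i.castSucc ≤ i.succ := fun i => i.castSucc_lt_succ.le
  have hsucc' : ∀ j : Fin m, j.castSucc.castSucc ≤ j.succ.castSucc :=
    fun j => hsucc j.castSucc
  have hsucc2 : ∀ j : Fin m, j.castSucc.castSucc ≤ j.succ.succ :=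
    fun j => (hsucc j.castSucc).trans (hsucc j.succ)
  simp only [hBr, hρt, hρr, hBt _ _ (hsucc _), hBt _ _ (hsucc' _), hBt _ _ (hsucc2 _),
    hBt 0 1 (Fin.zero_le 1), hBt _ _ (Fin.le_last _), e1, e2]
  rfl
end
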